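/- arXiv:1607.08556 — 4 statements merged into one kernel-verified Lean document; each statement's English description precedes it below -/
import Mathlib

section
/- Let V_1 = (Y_1,C_1,τ_1),…,V_k = (Y_k,C_k,τ_k) be infinitesimal symmetries of a smooth SDE (μ,σ) on an open set M ⊆ ℝ^n, spanning a Lie algebra under the bracket [V,V'] = ([Y,Y'], Y(C') − Y'(C) − (C·C' − C'·C), Y(τ') − Y'(τ)). If x₀ ∈ M is such that Y_1(x₀),…,Y_k(x₀) are linearly independent, then there exist an open neighborhood U of x₀ and a stochastic transformation T = (Φ,B,η) on U such that T_*(V_1),…,T_*(V_k) are strong infinitesimal symmetries (i.e., of the form (Y,0,0)) of the transformed SDE E_T(μ,σ). -/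
noncomputable section

open scoped BigOperators

/-- Partial derivative `∂_j f` at `x`. -/
def pd {d : ℕ} (f : (Fin d → ℝ) → ℝ) (j : Fin d) (x : Fin d → ℝ) : ℝ :=
  fderiv ℝ f x (Pi.single j 1)

/-- A vector field `Y` applied to a scalar function: `Y(f) = ∑ k Y^k ∂_k f`. -/
def vfApp {d : ℕ} (Y : (Fin d → ℝ) → Fin d → ℝ) (f : (Fin d → ℝ) → ℝ)
    (x : Fin d → ℝ) : ℝ :=
  ∑ k, Y x k * pd f k x

/-- Lie bracket of two vector fields. -/
def vfBracket {d : ℕ} (X Y : (Fin d → ℝ) → Fin d → ℝ) (x : Fin d → ℝ) :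
    Fin d → ℝ :=
  fun i => ∑ k, (X x k * pd (fun y => Y y i) k x - Y x k * pd (fun y => X y i) k x)

/-- The bracket `[H,K]` of a vector field `H` with a matrix-valued map `K`. -/
def mixBracket {d m : ℕ} (H : (Fin d → ℝ) → Fin d → ℝ)
    (K : (Fin d → ℝ) → Fin d → Fin m → ℝ) (x : Fin d → ℝ) : Fin d → Fin m → ℝ :=
  fun i j => ∑ k, (H x k * pd (fun y => K y i j) k x - K x k j * pd (fun y => H y i) k x)

/-- The generator `L` of the SDE `(μ,σ)`. -/
def gen {d m : ℕ} (μ : (Fin d → ℝ) → Fin d → ℝ)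
    (σ : (Fin d → ℝ) → Fin d → Fin m → ℝ)
    (f : (Fin d → ℝ) → ℝ) (x : Fin d → ℝ) : ℝ :=
  (1/2) * ∑ α : Fin m, ∑ i, ∑ j, σ x i α * σ x j α * pd (fun y => pd f j y) i x
    + ∑ i, μ x i * pd f i x

/-- The determining equations: `(Y,C,τ)` is an infinitesimal symmetry of `(μ,σ)` on `M`. -/
def IsSymmetry {d m : ℕ} (M : Set (Fin d → ℝ))
    (μ : (Fin d → ℝ) → Fin d → ℝ) (σ : (Fin d → ℝ) → Fin d → Fin m → ℝ)
    (Y : (Fin d → ℝ) → Fin d → ℝ) (C : (Fin d → ℝ) → Fin m → Fin m → ℝ)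
    (τ : (Fin d → ℝ) → ℝ) : Prop :=
  (∀ x ∈ M, ∀ i α, mixBracket Y σ x i α
      = -(1/2) * τ x * σ x i α - ∑ β, σ x i β * C x β α) ∧
  (∀ x ∈ M, ∀ i,
      vfApp Y (fun y => μ y i) x - gen μ σ (fun y => Y y i) x = - τ x * μ x i)

/-- Drift `μ' = ((1/η)·L(Φ)) ∘ Φ⁻¹` of the transformed SDE `E_T(μ,σ)`. -/
def transMu {d m : ℕ} (μ : (Fin d → ℝ) → Fin d → ℝ)
    (σ : (Fin d → ℝ) → Fin d → Fin m → ℝ)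
    (Φ Φinv : (Fin d → ℝ) → Fin d → ℝ) (η : (Fin d → ℝ) → ℝ) :
    (Fin d → ℝ) → Fin d → ℝ :=
  fun y i => (1 / η (Φinv y)) * gen μ σ (fun z => Φ z i) (Φinv y)

/-- Diffusion `σ' = ((1/√η)·∇Φ·σ·Bᵀ) ∘ Φ⁻¹` of the transformed SDE `E_T(μ,σ)`. -/
def transSigma {d m : ℕ} (σ : (Fin d → ℝ) → Fin d → Fin m → ℝ)
    (Φ Φinv : (Fin d → ℝ) → Fin d → ℝ)
    (B : (Fin d → ℝ) → Fin m → Fin m → ℝ) (η : (Fin d → ℝ) → ℝ) :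
    (Fin d → ℝ) → Fin d → Fin m → ℝ :=
  fun y i a => (1 / Real.sqrt (η (Φinv y))) *
    ∑ j, ∑ b, pd (fun z => Φ z i) j (Φinv y) * σ (Φinv y) j b * B (Φinv y) a b

/-- Push-forward `(∇Φ·Y) ∘ Φ⁻¹` of a vector field. -/
def pushVF {d : ℕ} (Φ Φinv : (Fin d → ℝ) → Fin d → ℝ)
    (Y : (Fin d → ℝ) → Fin d → ℝ) : (Fin d → ℝ) → Fin d → ℝ :=
  fun y i => ∑ j, pd (fun z => Φ z i) j (Φinv y) * Y (Φinv y) j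

/-- The component `(B·C·B⁻¹ + Y(B)·B⁻¹) ∘ Φ⁻¹` of the push-forward `T_*(V)`. -/
def pushC {d m : ℕ} (Φinv : (Fin d → ℝ) → Fin d → ℝ)
    (B : (Fin d → ℝ) → Fin m → Fin m → ℝ)
    (Y : (Fin d → ℝ) → Fin d → ℝ)
    (C : (Fin d → ℝ) → Fin m → Fin m → ℝ) :
    (Fin d → ℝ) → Fin m → Fin m → ℝ :=
  fun y a b =>
    ((Matrix.of (B (Φinv y)) * Matrix.of (C (Φinv y)) * (Matrix.of (B (Φinv y)))⁻¹
      + Matrix.of (fun a' b' => vfApp Y (fun z => B z a' b') (Φinv y))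
        * (Matrix.of (B (Φinv y)))⁻¹ : Matrix (Fin m) (Fin m) ℝ)) a b

/-- The component `(τ + Y(η)·η⁻¹) ∘ Φ⁻¹` of the push-forward `T_*(V)`. -/
def pushTau {d : ℕ} (Φinv : (Fin d → ℝ) → Fin d → ℝ)
    (Y : (Fin d → ℝ) → Fin d → ℝ) (η : (Fin d → ℝ) → ℝ)
    (τ : (Fin d → ℝ) → ℝ) : (Fin d → ℝ) → ℝ :=
  fun y => τ (Φinv y) + vfApp Y η (Φinv y) / η (Φinv y)

section

open Set Filter Topology
open scoped ContDiff unitInterval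

section Superposition

variable {α : Type*} [TopologicalSpace α] [CompactSpace α]

/-- Pointwise application of operator-valued continuous maps, as a continuous bilinear map. -/
noncomputable def ContinuousMap.pointwiseApplyL (α : Type*) [TopologicalSpace α] [CompactSpace α]
    (E F : Type*) [NormedAddCommGroup E] [NormedSpace ℝ E]
    [NormedAddCommGroup F] [NormedSpace ℝ F] :
    C(α, E →L[ℝ] F) →L[ℝ] C(α, E) →L[ℝ] C(α, F) :=
  LinearMap.mkContinuous₂
    (LinearMap.mk₂ ℝ
      (fun (A : C(α, E →L[ℝ] F)) (γ : C(α, E)) =>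
        (⟨fun s => A s (γ s), A.continuous.clm_apply γ.continuous⟩ : C(α, F)))
      (fun _ _ _ => by ext; simp) (fun _ _ _ => by ext; simp)
      (fun _ _ _ => by ext; simp) (fun _ _ _ => by ext; simp)) 1
    (fun A γ => by
      rw [one_mul]
      refine (ContinuousMap.norm_le _ (by positivity)).2 fun s => ?_
      exact ((A s).le_opNorm _).trans
        (mul_le_mul (A.norm_coe_le_norm s) (γ.norm_coe_le_norm s) (norm_nonneg _) (norm_nonneg A)))

@[simp]
theorem ContinuousMap.pointwiseApplyL_apply {E F : Type*} [NormedAddCommGroup E] [NormedSpace ℝ E]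
    [NormedAddCommGroup F] [NormedSpace ℝ F] (A : C(α, E →L[ℝ] F)) (γ : C(α, E)) (s : α) :
    ContinuousMap.pointwiseApplyL α E F A γ s = A s (γ s) := rfl

theorem ContinuousMap.hasFDerivAt_comp_left {E F : Type*} [NormedAddCommGroup E] [NormedSpace ℝ E]
    [NormedAddCommGroup F] [NormedSpace ℝ F] (f : C(E, F)) (f' : C(E, E →L[ℝ] F))
    (hf : ∀ x, HasFDerivAt f (f' x) x) (γ : C(α, E)) :
    HasFDerivAt (fun γ : C(α, E) => f.comp γ)
      (ContinuousMap.pointwiseApplyL α E F (f'.comp γ)) γ := by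
  rw [hasFDerivAt_iff_isLittleO_nhds_zero, Asymptotics.isLittleO_iff]
  intro ε hε
  have hc : ContinuousAt (fun γ : C(α, E) => f'.comp γ) γ :=
    (ContinuousMap.continuous_postcomp f').continuousAt
  obtain ⟨δ, hδ, hball⟩ := (Metric.continuousAt_iff (f := fun γ : C(α, E) => f'.comp γ)).1 hc ε hε
  filter_upwards [Metric.ball_mem_nhds (0 : C(α, E)) hδ] with h hh
  refine (ContinuousMap.norm_le _ (by positivity)).2 fun s => ?_
  have hbound : ∀ u ∈ Metric.ball (γ s) δ, ‖f' u - f' (γ s)‖ ≤ ε := by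
    intro u hu
    have h1 : dist (γ + ContinuousMap.const α (u - γ s)) γ < δ := by
      rw [dist_eq_norm, add_sub_cancel_left]
      refine lt_of_le_of_lt ((ContinuousMap.norm_le _ (norm_nonneg (u - γ s))).2 ?_)
        (by rwa [Metric.mem_ball, dist_eq_norm] at hu)
      simp
    have h2 := (ContinuousMap.dist_apply_le_dist
      (f := f'.comp (γ + ContinuousMap.const α (u - γ s)))
      (g := f'.comp γ) s).trans (hball h1).le
    simpa [dist_eq_norm] using h2
  have hs : γ s + h s ∈ Metric.ball (γ s) δ := by
    rw [Metric.mem_ball, dist_eq_norm, add_sub_cancel_left]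
    exact (h.norm_coe_le_norm s).trans_lt (by simpa using hh)
  have := (convex_ball (γ s) δ).norm_image_sub_le_of_norm_hasFDerivWithin_le'
    (fun u _ => (hf u).hasFDerivWithinAt) hbound (Metric.mem_ball_self hδ) hs
  simp only [add_sub_cancel_left] at this
  refine le_trans (by simpa using this) ?_
  exact mul_le_mul_of_nonneg_left (h.norm_coe_le_norm s) hε.le

universe u in
theorem ContinuousMap.contDiff_comp_left {E : Type u} [NormedAddCommGroup E] [NormedSpace ℝ E]
    {F : Type u} [NormedAddCommGroup F] [NormedSpace ℝ F] (f : C(E, F)) (hf : ContDiff ℝ ∞ f) :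
    ContDiff ℝ ∞ (fun γ : C(α, E) => f.comp γ) := by
  rw [contDiff_infty]
  intro n
  induction n generalizing F with
  | zero => exact contDiff_zero.2 (ContinuousMap.continuous_postcomp f)
  | succ n ih =>
    have hf' : ContDiff ℝ ∞ (fderiv ℝ f) := hf.fderiv_right (by simp)
    rw [Nat.cast_succ, contDiff_succ_iff_hasFDerivAt]
    exact ⟨fun γ => ContinuousMap.pointwiseApplyL α E F
        ((⟨fderiv ℝ f, hf'.continuous⟩ : C(E, E →L[ℝ] F)).comp γ),
      ContDiff.comp (g := ContinuousMap.pointwiseApplyL α E F) (by fun_prop)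
        (ih ⟨fderiv ℝ f, hf'.continuous⟩ hf'),
      fun γ => ContinuousMap.hasFDerivAt_comp_left f ⟨fderiv ℝ f, hf'.continuous⟩
        (fun x => (hf.differentiable (by simp) x).hasFDerivAt) γ⟩

end Superposition

section Primitive

variable {E : Type*} [NormedAddCommGroup E] [NormedSpace ℝ E]

/-- The primitive vanishing at `0` of a curve on the unit interval, as a continuous linear map. -/
noncomputable def primitiveL (E : Type*) [NormedAddCommGroup E] [NormedSpace ℝ E] :
    C(I, E) →L[ℝ] C(I, E) :=
  LinearMap.mkContinuous
    { toFun := fun γ => ⟨fun s => ∫ r in (0 : ℝ)..s, IccExtend zero_le_one γ r,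
        (intervalIntegral.continuous_primitive
          (fun _ _ => (γ.continuous.Icc_extend' (h := zero_le_one)).intervalIntegrable _ _) 0).comp
          continuous_subtype_val⟩
      map_add' := fun γ γ' => by
        ext s
        exact intervalIntegral.integral_add
          ((γ.continuous.Icc_extend' (h := zero_le_one)).intervalIntegrable _ _)
          ((γ'.continuous.Icc_extend' (h := zero_le_one)).intervalIntegrable _ _)
      map_smul' := fun a γ => by
        ext s
        exact intervalIntegral.integral_smul a (IccExtend zero_le_one γ) } 1
    (fun γ => by
      rw [one_mul]
      refine (ContinuousMap.norm_le _ (norm_nonneg γ)).2 fun s => ?_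
      refine (intervalIntegral.norm_integral_le_of_norm_le_const
        (fun r _ => γ.norm_coe_le_norm _)).trans ?_
      rw [sub_zero, abs_of_nonneg s.2.1]
      exact mul_le_of_le_one_right (norm_nonneg γ) s.2.2)

theorem primitiveL_apply (γ : C(I, E)) (s : I) :
    primitiveL E γ s = ∫ r in (0 : ℝ)..s, IccExtend zero_le_one γ r := rfl

theorem primitiveL_eq_of_hasDerivAt [CompleteSpace E] {u : C(I, E)} {g : ℝ → E} (h0 : g 0 = 0)
    (hg : ∀ s : I, HasDerivAt g (u s) s) (s : I) : primitiveL E u s = g s := by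
  rw [primitiveL_apply, intervalIntegral.integral_eq_sub_of_hasDerivAt (f := g)
    (fun r hr => ?_) ((u.continuous.Icc_extend' (h := zero_le_one)).intervalIntegrable _ _),
    h0, sub_zero]
  rw [uIcc_of_le s.2.1] at hr
  have hr' : r ∈ Icc (0 : ℝ) 1 := ⟨hr.1, hr.2.trans s.2.2⟩
  rw [IccExtend_of_mem _ _ hr']
  exact hg ⟨r, hr'⟩

theorem hasDerivAt_primitive [CompleteSpace E] (u : C(I, E)) (s : I) :
    HasDerivAt (fun x : ℝ => ∫ r in (0 : ℝ)..x, IccExtend zero_le_one u r) (u s) s := by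
  have hc : Continuous (IccExtend (zero_le_one (α := ℝ)) u) :=
    u.continuous.Icc_extend' (h := zero_le_one)
  have := hc.integral_hasStrictDerivAt 0 (s : ℝ)
  simpa using this.hasDerivAt

end Primitive

/-- Inverse function theorem for smooth maps, with a local inverse that is smooth on a whole
neighbourhood. -/
theorem exists_smooth_local_inverse {E F : Type*} [NormedAddCommGroup E] [NormedSpace ℝ E]
    [NormedAddCommGroup F] [NormedSpace ℝ F] [CompleteSpace E] {f : E → F} {a : E} (f' : E ≃L[ℝ] F)
    (hf : ∀ᶠ x in 𝓝 a, ContDiffAt ℝ ∞ f x) (hf' : HasFDerivAt f (f' : E →L[ℝ] F) a) :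
    ∃ g : F → E, g (f a) = a ∧ (∀ᶠ y in 𝓝 (f a), ContDiffAt ℝ ∞ g y ∧ f (g y) = y) ∧
      ∀ᶠ x in 𝓝 a, g (f x) = x ∧ ∀ v, fderiv ℝ g (f x) (fderiv ℝ f x v) = v := by
  have ha := hf.self_of_nhds
  have hs : HasStrictFDerivAt f (f' : E →L[ℝ] F) a := ha.hasStrictFDerivAt' hf' (by simp)
  set e := hs.toOpenPartialHomeomorph f with he
  have hcoe : (e : E → F) = f := rfl
  have hae : a ∈ e.source := hs.mem_toOpenPartialHomeomorph_source
  have hfae : f a ∈ e.target := hs.image_mem_toOpenPartialHomeomorph_target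
  have hga : e.symm (f a) = a := e.left_inv hae
  have hcont : Tendsto e.symm (𝓝 (f a)) (𝓝 a) := by
    simpa only [ContinuousAt, hga] using e.continuousAt_symm hfae
  have hinv : ∀ᶠ x in 𝓝 a, ∃ A : E ≃L[ℝ] F, HasFDerivAt f (A : E →L[ℝ] F) x := by
    have h1 : ContinuousAt (fderiv ℝ f) a :=
      (ha.fderiv_right (m := 0) (by simp)).continuousAt
    have h2 : range ((↑) : (E ≃L[ℝ] F) → E →L[ℝ] F) ∈ 𝓝 (fderiv ℝ f a) := by
      rw [hf'.fderiv]; exact f'.nhds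
    filter_upwards [h1 h2, hf] with x hx hfx
    obtain ⟨A, hA⟩ := hx
    exact ⟨A, hA ▸ (hfx.differentiableAt (by simp)).hasFDerivAt⟩
  have hsm : ∀ᶠ y in 𝓝 (f a), ContDiffAt ℝ ∞ e.symm y ∧ f (e.symm y) = y := by
    filter_upwards [hcont.eventually hinv, hcont.eventually hf, e.open_target.mem_nhds hfae]
      with y hy hfy hyt
    obtain ⟨A, hA⟩ := hy
    exact ⟨e.contDiffAt_symm hyt hA hfy, e.right_inv hyt⟩
  refine ⟨e.symm, hga, hsm, ?_⟩
  have hleft : ∀ᶠ x in 𝓝 a, e.symm (f x) = x := e.eventually_left_inverse hae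
  filter_upwards [hleft.eventually_nhds, hf, ha.continuousAt.eventually hsm] with x hx hfx hgx
  refine ⟨hx.self_of_nhds, fun v => ?_⟩
  have h1 : HasFDerivAt (e.symm ∘ f) ((fderiv ℝ e.symm (f x)).comp (fderiv ℝ f x)) x :=
    (hgx.1.differentiableAt (by simp)).hasFDerivAt.comp x
      (hfx.differentiableAt (by simp)).hasFDerivAt
  have h2 : HasFDerivAt (e.symm ∘ f) (ContinuousLinearMap.id ℝ E) x :=
    (hasFDerivAt_id x).congr_of_eventuallyEq hx
  exact congrArg (fun L : E →L[ℝ] E => L v) (h1.unique h2)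

/-- A map smooth near a point agrees near that point with a globally smooth map. -/
theorem exists_contDiff_eventuallyEq {E F : Type*} [NormedAddCommGroup E] [NormedSpace ℝ E]
    [FiniteDimensional ℝ E] [NormedAddCommGroup F] [NormedSpace ℝ F] {f : E → F} {M : Set E}
    (hM : IsOpen M) (hf : ContDiffOn ℝ ∞ f M) {x₀ : E} (hx₀ : x₀ ∈ M) :
    ∃ g : E → F, ContDiff ℝ ∞ g ∧ g =ᶠ[𝓝 x₀] f := by
  obtain ⟨δ, hδ, hball⟩ := Metric.isOpen_iff.1 hM x₀ hx₀
  let ρ : ContDiffBump x₀ := ⟨δ / 4, δ / 2, by positivity, by linarith⟩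
  refine ⟨fun x => ρ x • f x, contDiff_iff_contDiffAt.2 fun x => ?_, ?_⟩
  · by_cases hx : x ∈ M
    · exact ρ.contDiffAt.smul (hf.contDiffAt (hM.mem_nhds hx))
    · have hxt : x ∉ tsupport ρ := by
        rw [ρ.tsupport_eq]
        exact fun h => hx (hball (Metric.closedBall_subset_ball (by
          change δ / 2 < δ
          linarith) h))
      refine (contDiffAt_const (c := (0 : F))).congr_of_eventuallyEq ?_
      filter_upwards [notMem_tsupport_iff_eventuallyEq.1 hxt] with y hy
      simp [hy]
  · filter_upwards [ρ.eventuallyEq_one] with y hy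
    simp [hy]

/-- The primitive `∫₀ˢ exp (r M) dr`. -/
noncomputable def expPrimitive {A : Type*} [NormedRing A] [NormedAlgebra ℝ A]
    (M : A) (s : ℝ) : A :=
  ∫ r in (0 : ℝ)..s, NormedSpace.exp (r • M)

theorem expPrimitive_apply_zero {A : Type*} [NormedRing A] [NormedAlgebra ℝ A] (M : A) :
    expPrimitive M 0 = 0 :=
  intervalIntegral.integral_same

section ExpPrimitive

variable {A : Type*} [NormedRing A] [NormedAlgebra ℝ A] [CompleteSpace A]

theorem hasDerivAt_exp_smul_const_left (M : A) (s : ℝ) :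
    HasDerivAt (fun r : ℝ => NormedSpace.exp (r • M)) (M * NormedSpace.exp (s • M)) s :=
  hasDerivAt_exp_smul_const' M s

theorem hasDerivAt_expPrimitive (M : A) (s : ℝ) :
    HasDerivAt (expPrimitive M) (1 + M * expPrimitive M s) s := by
  have hc : Continuous fun r : ℝ => NormedSpace.exp (r • M) :=
    continuous_iff_continuousAt.2 fun r => (hasDerivAt_exp_smul_const_left M r).continuousAt
  have h1 : M * expPrimitive M s = NormedSpace.exp (s • M) - 1 := by
    have h2 := intervalIntegral.integral_eq_sub_of_hasDerivAt (a := 0) (b := s)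
      (fun r _ => hasDerivAt_exp_smul_const_left M r)
      ((continuous_const.mul hc).intervalIntegrable _ _)
    rw [zero_smul, NormedSpace.exp_zero] at h2
    rw [← h2, expPrimitive]
    exact ((ContinuousLinearMap.mul ℝ A M).intervalIntegral_comp_comm
      (hc.intervalIntegrable _ _)).symm
  rw [h1, add_sub_cancel]
  exact (hc.integral_hasStrictDerivAt 0 s).hasDerivAt

theorem expPrimitive_zero_one : expPrimitive (0 : A) 1 = 1 := by
  simp [expPrimitive]

end ExpPrimitive

/-- Smooth dependence on `(t, ζ)` of the solution `γ` of `γ = ζ + J (∑ i, t i • ν i γ)`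
near `t = 0`. -/
theorem exists_smooth_solution_map {Γ : Type*} [NormedAddCommGroup Γ] [NormedSpace ℝ Γ]
    [CompleteSpace Γ] {k : ℕ} (J : Γ →L[ℝ] Γ) (ν : Fin k → Γ → Γ)
    (hν : ∀ i, ContDiff ℝ ∞ (ν i)) (γ₀ : Γ) :
    ∃ S : (Fin k → ℝ) × Γ → Γ, S (0, γ₀) = γ₀ ∧ (∀ᶠ ζ in 𝓝 γ₀, S (0, ζ) = ζ) ∧
      ∀ᶠ q in 𝓝 ((0 : Fin k → ℝ), γ₀), ContDiffAt ℝ ∞ S q ∧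
        S q = q.2 + J (∑ i, q.1 i • ν i (S q)) ∧
        ∀ v w, w = J (∑ i, (v i • ν i (S q) + q.1 i • fderiv ℝ (ν i) (S q) w)) →
          fderiv ℝ S q (v, 0) = w := by
  set Q : (Fin k → ℝ) × Γ → (Fin k → ℝ) × Γ :=
    fun x => (x.1, x.2 - J (∑ i, x.1 i • ν i x.2)) with hQ
  have hQs : ContDiff ℝ ∞ Q := by
    have hν' : ∀ i, ContDiff ℝ ∞ fun x : (Fin k → ℝ) × Γ => ν i x.2 :=
      fun i => (hν i).comp contDiff_snd
    have ht : ∀ i, ContDiff ℝ ∞ fun x : (Fin k → ℝ) × Γ => x.1 i :=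
      fun i => (contDiff_apply ℝ ℝ i).comp contDiff_fst
    exact contDiff_fst.prodMk (contDiff_snd.sub (J.contDiff.comp
      (ContDiff.sum fun i _ => (ht i).smul (hν' i))))
  set Q' : (Fin k → ℝ) × Γ → ((Fin k → ℝ) × Γ →L[ℝ] (Fin k → ℝ) × Γ) := fun x =>
    (ContinuousLinearMap.fst ℝ _ _).prod (ContinuousLinearMap.snd ℝ _ _ - J.comp (∑ i,
      (x.1 i • (fderiv ℝ (ν i) x.2).comp (ContinuousLinearMap.snd ℝ _ _) +
        ((ContinuousLinearMap.proj i).comp (ContinuousLinearMap.fst ℝ _ _)).smulRight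
          (ν i x.2)))) with hQ'
  have hQd : ∀ x, HasFDerivAt Q (Q' x) x := by
    intro x
    have hν' : ∀ i, HasFDerivAt (fun x : (Fin k → ℝ) × Γ => ν i x.2)
        ((fderiv ℝ (ν i) x.2).comp (ContinuousLinearMap.snd ℝ _ _)) x := fun i =>
      ((hν i).differentiable (by simp) x.2).hasFDerivAt.comp x hasFDerivAt_snd
    have ht : ∀ i, HasFDerivAt (fun x : (Fin k → ℝ) × Γ => x.1 i)
        ((ContinuousLinearMap.proj i).comp (ContinuousLinearMap.fst ℝ (Fin k → ℝ) Γ)) x :=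
      fun i => ((ContinuousLinearMap.proj i).comp
        (ContinuousLinearMap.fst ℝ (Fin k → ℝ) Γ)).hasFDerivAt
    exact hasFDerivAt_fst.prodMk (hasFDerivAt_snd.sub (J.hasFDerivAt.comp x
      (HasFDerivAt.fun_sum fun i _ => (ht i).smul (hν' i))))
  have hQ'v : ∀ x v w, Q' x (v, w) =
      (v, w - J (∑ i, (v i • ν i x.2 + x.1 i • fderiv ℝ (ν i) x.2 w))) := by
    intro x v w
    simp [hQ', add_comm]
  set T : (Fin k → ℝ) →L[ℝ] Γ :=
    J.comp (∑ i, (ContinuousLinearMap.proj (R := ℝ) i).smulRight (ν i γ₀)) with hT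
  set e : ((Fin k → ℝ) × Γ) ≃L[ℝ] (Fin k → ℝ) × Γ := ContinuousLinearEquiv.equivOfInverse
    ((ContinuousLinearMap.fst ℝ _ _).prod (ContinuousLinearMap.snd ℝ _ _ -
      T.comp (ContinuousLinearMap.fst ℝ _ _)))
    ((ContinuousLinearMap.fst ℝ _ _).prod (ContinuousLinearMap.snd ℝ _ _ +
      T.comp (ContinuousLinearMap.fst ℝ _ _)))
    (fun x => by simp) (fun x => by simp) with he
  have hQ0 : Q (0, γ₀) = (0, γ₀) := by simp [hQ]
  have hed : HasFDerivAt Q (e : (Fin k → ℝ) × Γ →L[ℝ] (Fin k → ℝ) × Γ) (0, γ₀) := by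
    convert! hQd (0, γ₀) using 1
    refine ContinuousLinearMap.ext fun ⟨v, w⟩ => ?_
    rw [hQ'v]
    simp [he, hT]
  obtain ⟨g, hg0, hgs, hgl⟩ := exists_smooth_local_inverse e
    (Eventually.of_forall fun x => hQs.contDiffAt) hed
  rw [hQ0] at hg0 hgs
  refine ⟨fun q => (g q).2, by simp [hg0], ?_, ?_⟩
  · have hc : Tendsto (fun ζ : Γ => ((0 : Fin k → ℝ), ζ)) (𝓝 γ₀) (𝓝 (0, γ₀)) :=
      (by fun_prop : Continuous fun ζ : Γ => ((0 : Fin k → ℝ), ζ)).continuousAt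
    filter_upwards [hc.eventually hgl] with ζ hζ
    have : Q (0, ζ) = (0, ζ) := by simp [hQ]
    rw [← this, hζ.1]
  · have hgc : Tendsto g (𝓝 (0, γ₀)) (𝓝 (0, γ₀)) := by
      have := hgs.self_of_nhds.1.continuousAt
      rwa [ContinuousAt, hg0] at this
    filter_upwards [hgs, hgc.eventually hgl] with q hq hql
    have h1 : (Q (g q)).1 = q.1 := congrArg Prod.fst hq.2
    change (g q).1 = q.1 at h1
    have h2 : (g q).2 - J (∑ i, (g q).1 i • ν i (g q).2) = q.2 :=
      (congrArg Prod.snd hq.2 : (Q (g q)).2 = q.2)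
    refine ⟨contDiffAt_snd.comp q hq.1, ?_, fun v w hw => ?_⟩
    · rw [← h2, h1]; abel
    · have h3 := hql.2 (v, w)
      rw [hq.2, (hQd (g q)).fderiv, hQ'v, h1, ← hw, sub_self] at h3
      have h4 : HasFDerivAt (fun q => (g q).2)
          ((ContinuousLinearMap.snd ℝ _ _).comp (fderiv ℝ g q)) q :=
        hasFDerivAt_snd.comp q (hq.1.differentiableAt (by simp)).hasFDerivAt
      rw [h4.fderiv, ContinuousLinearMap.comp_apply, h3]
      rfl

/-- The matrix of `a ↦ ∑ l i, a l * t i * c l i ·`, the adjoint action in the Lie algebra with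
structure constants `c`. -/
noncomputable def structureAd {k : ℕ} (c : Fin k → Fin k → Fin k → ℝ) (t : Fin k → ℝ) :
    (Fin k → ℝ) →L[ℝ] (Fin k → ℝ) :=
  LinearMap.toContinuousLinearMap
    (Matrix.mulVecLin (Matrix.of fun p l => ∑ i, t i * c l i p))

theorem structureAd_apply {k : ℕ} (c : Fin k → Fin k → Fin k → ℝ) (t a : Fin k → ℝ) (p : Fin k) :
    structureAd c t a p = ∑ l, (∑ i, t i * c l i p) * a l := rfl

theorem structureAd_zero {k : ℕ} (c : Fin k → Fin k → Fin k → ℝ) : structureAd c 0 = 0 := by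
  ext a p
  simp [structureAd_apply]

theorem structureAd_variation {E : Type*} [AddCommGroup E] [Module ℝ E] {k : ℕ}
    (c : Fin k → Fin k → Fin k → ℝ) (t a v : Fin k → ℝ) (z : Fin k → E) (d : Fin k → Fin k → E)
    (h : ∀ i j, d j i - d i j = ∑ l, c i j l • z l) :
    ∑ l, ((v l + structureAd c t a l) • z l + a l • ∑ i, t i • d l i) =
      ∑ i, (v i • z i + t i • ∑ l, a l • d i l) := by
  have h1 : ∑ l, structureAd c t a l • z l = ∑ l, ∑ i, (a l * t i) • (d i l - d l i) := by
    simp only [h, structureAd_apply, Finset.sum_smul, Finset.smul_sum, Finset.sum_mul, smul_smul]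
    rw [Finset.sum_comm]
    refine Finset.sum_congr rfl fun l _ => ?_
    rw [Finset.sum_comm]
    refine Finset.sum_congr rfl fun i _ => Finset.sum_congr rfl fun p _ => ?_
    congr 1; ring
  have h2 : ∑ i, t i • ∑ l, a l • d i l = ∑ l, ∑ i, (a l * t i) • d i l := by
    simp only [Finset.smul_sum, smul_smul]
    rw [Finset.sum_comm]
    simp only [mul_comm]
  have h3 : ∑ l, a l • ∑ i, t i • d l i = ∑ l, ∑ i, (a l * t i) • d l i := by
    simp only [Finset.smul_sum, smul_smul]
  simp only [add_smul, Finset.sum_add_distrib, h1, h2, h3, smul_sub, Finset.sum_sub_distrib]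
  abel

universe u in
/-- A family of smooth vector fields closed under brackets with constant structure constants
integrates near `p` to a smooth map `χ (t, z)` whose `t`-derivatives are combinations of
the fields. -/
theorem exists_canonical_coordinates {E : Type u} [NormedAddCommGroup E] [NormedSpace ℝ E]
    [CompleteSpace E] {k : ℕ} (Z : Fin k → E → E) (hZ : ∀ i, ContDiff ℝ ∞ (Z i)) (p : E)
    (c : Fin k → Fin k → Fin k → ℝ)
    (hbr : ∀ᶠ z in 𝓝 p, ∀ i j,
      fderiv ℝ (Z j) z (Z i z) - fderiv ℝ (Z i) z (Z j z) = ∑ l, c i j l • Z l z) :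
    ∃ (χ : (Fin k → ℝ) × E → E) (φ : (Fin k → ℝ) → ((Fin k → ℝ) →L[ℝ] (Fin k → ℝ))),
      (∀ᶠ z in 𝓝 p, χ (0, z) = z) ∧ φ 0 = 1 ∧
      ∀ᶠ q in 𝓝 ((0 : Fin k → ℝ), p), ContDiffAt ℝ ∞ χ q ∧
        ∀ v, fderiv ℝ χ q (v, 0) = ∑ l, φ q.1 v l • Z l (χ q) := by
  set N : Fin k → C(E, E) := fun i => ⟨Z i, (hZ i).continuous⟩ with hN
  set N' : Fin k → C(E, E →L[ℝ] E) :=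
    fun i => ⟨fderiv ℝ (Z i), (hZ i).continuous_fderiv (by simp)⟩ with hN'
  have hνd : ∀ i (γ : C(I, E)), fderiv ℝ (fun γ : C(I, E) => (N i).comp γ) γ =
      ContinuousMap.pointwiseApplyL I E E ((N' i).comp γ) := fun i γ =>
    (ContinuousMap.hasFDerivAt_comp_left (N i) (N' i)
      (fun x => ((hZ i).differentiable (by simp) x).hasFDerivAt) γ).fderiv
  set ι : E →L[ℝ] C(I, E) := LinearMap.mkContinuous
    { toFun := fun z => ContinuousMap.const I z
      map_add' := fun _ _ => rfl
      map_smul' := fun _ _ => rfl } 1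
    (fun z => by
      rw [one_mul]
      exact (ContinuousMap.norm_le _ (norm_nonneg z)).2 fun _ => le_rfl) with hι
  have hιa : ∀ z s, ι z s = z := fun _ _ => rfl
  obtain ⟨S, hS0, hSζ, hS⟩ := exists_smooth_solution_map (primitiveL E)
    (fun i (γ : C(I, E)) => (N i).comp γ)
    (fun i => ContinuousMap.contDiff_comp_left (N i) (hZ i)) (ι p)
  set κ : (Fin k → ℝ) × E →L[ℝ] (Fin k → ℝ) × C(I, E) :=
    (ContinuousLinearMap.fst ℝ _ _).prod (ι.comp (ContinuousLinearMap.snd ℝ _ _)) with hκ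
  set ev : C(I, E) →L[ℝ] E := ContinuousMap.evalCLM ℝ (1 : I) with hev
  have hκt : Tendsto κ (𝓝 (0, p)) (𝓝 (0, ι p)) := κ.continuous.tendsto (0, p)
  have hSc : Tendsto S (𝓝 (0, ι p)) (𝓝 (ι p)) := by
    have := hS.self_of_nhds.1.continuousAt
    rwa [ContinuousAt, hS0] at this
  have hgood : ∀ᶠ γ in 𝓝 (ι p), ∀ s : I, ∀ i j,
      fderiv ℝ (Z j) (γ s) (Z i (γ s)) - fderiv ℝ (Z i) (γ s) (Z j (γ s)) =
        ∑ l, c i j l • Z l (γ s) := by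
    obtain ⟨δ, hδ, hball⟩ := Metric.eventually_nhds_iff.1 hbr
    filter_upwards [Metric.ball_mem_nhds (ι p) hδ] with γ hγ s
    exact hball ((ContinuousMap.dist_apply_le_dist (f := γ) (g := ι p) s).trans_lt hγ)
  refine ⟨fun q => ev (S (κ q)), fun t => expPrimitive (structureAd c t) 1, ?_, ?_, ?_⟩
  · filter_upwards [(ι.continuous.tendsto p).eventually hSζ] with z hz
    change S (0, ι z) 1 = z
    rw [hz, hιa]
  · simp only [structureAd_zero, expPrimitive_zero_one]
  filter_upwards [hκt.eventually hS, (hSc.comp hκt).eventually hgood] with q hq hqg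
  obtain ⟨hqs, hqe, hqd⟩ := hq
  refine ⟨ev.contDiff.contDiffAt.comp q (hqs.comp q κ.contDiff.contDiffAt), fun v => ?_⟩
  have h1 : HasFDerivAt (fun q => ev (S (κ q))) (ev.comp ((fderiv ℝ S (κ q)).comp κ)) q :=
    ev.hasFDerivAt.comp q ((hqs.differentiableAt (by simp)).hasFDerivAt.comp q κ.hasFDerivAt)
  rw [h1.fderiv]
  obtain ⟨t, z⟩ := q
  have hκq : κ (t, z) = (t, ι z) := rfl
  have hκv : κ (v, 0) = (v, 0) := by
    change (v, ι 0) = (v, 0)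
    rw [map_zero]
  rw [ContinuousLinearMap.comp_apply, ContinuousLinearMap.comp_apply, hκv]
  rw [hκq] at hqe hqd ⊢
  simp only [Function.comp_apply, hκq] at hqg
  set γ := S (t, ι z) with hγ
  set U : C(I, E) := ∑ i, t i • (N i).comp γ with hU
  have hUs : ∀ s, U s = ∑ i, t i • Z i (γ s) := fun s => by simp [hU, hN]
  set γ' : ℝ → E := fun x => z + ∫ r in (0 : ℝ)..x, IccExtend zero_le_one U r with hγ'
  have hγγ' : ∀ s : I, γ' s = γ s := fun s =>
    (congrArg (fun g : C(I, E) => g s) hqe).symm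
  have hγd : ∀ s : I, HasDerivAt γ' (U s) s := fun s =>
    (hasDerivAt_primitive U s).const_add z
  set a : ℝ → Fin k → ℝ := fun s => expPrimitive (structureAd c t) s v with ha
  have had : ∀ s l, HasDerivAt (fun s => a s l) (v l + structureAd c t (a s) l) s := by
    intro s l
    have h2 := ((ContinuousLinearMap.proj (R := ℝ) (φ := fun _ : Fin k => ℝ) l).comp
      (ContinuousLinearMap.apply ℝ (Fin k → ℝ) v)).hasFDerivAt.comp_hasDerivAt s
        (hasDerivAt_expPrimitive (structureAd c t) s)
    exact h2
  have hac : ∀ l, Continuous fun s : I => a s l := fun l =>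
    (continuous_iff_continuousAt.2 fun s => (had s l).continuousAt).comp continuous_subtype_val
  set w : C(I, E) := ⟨fun s => ∑ l, a s l • Z l (γ s), by
    refine continuous_finsetSum _ fun l _ => (hac l).smul ((hZ l).continuous.comp γ.continuous)⟩
    with hw
  rw [hqd v w]
  · rfl
  ext s
  refine Eq.trans ?_ (primitiveL_eq_of_hasDerivAt (g := fun s => ∑ l, a s l • Z l (γ' s)) ?_
    (fun s => ?_) s).symm
  · simp only [hγγ']
    rfl
  · simp [ha, expPrimitive_apply_zero]
  · have h3 : HasDerivAt (fun s => ∑ l, a s l • Z l (γ' s))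
        (∑ l, (a s l • fderiv ℝ (Z l) (γ s) (U s) +
          (v l + structureAd c t (a s) l) • Z l (γ s))) s := by
      refine HasDerivAt.fun_sum fun l _ => ?_
      have h4 :=
        ((hZ l).differentiable (by simp) (γ' s)).hasFDerivAt.comp_hasDerivAt (s : ℝ) (hγd s)
      have h5 := (had s l).smul h4
      simp only [Function.comp_apply, hγγ'] at h5
      exact h5
    convert! h3 using 1
    have h6 := structureAd_variation c t (a s) v (fun i => Z i (γ s))
      (fun i j => fderiv ℝ (Z i) (γ s) (Z j (γ s))) (hqg s)
    simp only [hUs, map_sum, map_smul, hνd]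
    refine Eq.trans ?_ (h6.symm.trans (Finset.sum_congr rfl fun l _ => add_comm _ _))
    simp [hN, hN', hw]

/-- Linearly independent vectors together with a complement of their span parametrize the space. -/
theorem LinearIndependent.exists_complement_equiv {X : Type*} [NormedAddCommGroup X]
    [NormedSpace ℝ X] [FiniteDimensional ℝ X] {k : ℕ} {y : Fin k → X}
    (hy : LinearIndependent ℝ y) :
    ∃ (W : Submodule ℝ X) (e : ((Fin k → ℝ) × W) ≃L[ℝ] X),
      ∀ v w, e (v, w) = ∑ l, v l • y l + w := by
  obtain ⟨W, hW⟩ := Submodule.exists_isCompl (Submodule.span ℝ (range y))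
  set L : (Fin k → ℝ) × W →ₗ[ℝ] X :=
    (Fintype.linearCombination ℝ y).coprod W.subtype with hL
  have hLa : ∀ v w, L (v, w) = ∑ l, v l • y l + w := fun v w => by
    simp [hL, Fintype.linearCombination_apply]
  have hmem : ∀ v : Fin k → ℝ, ∑ l, v l • y l ∈ Submodule.span ℝ (range y) := fun v =>
    Submodule.sum_mem _ fun l _ => Submodule.smul_mem _ _ (Submodule.subset_span ⟨l, rfl⟩)
  have hinj : Function.Injective L := by
    rw [← LinearMap.ker_eq_bot, LinearMap.ker_eq_bot']
    rintro ⟨v, w⟩ h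
    rw [hLa] at h
    have h1 : (w : X) = 0 := by
      refine Submodule.disjoint_def.1 hW.disjoint _ ?_ w.2
      rw [← neg_eq_of_add_eq_zero_right h]
      exact Submodule.neg_mem _ (hmem v)
    rw [h1, add_zero] at h
    exact Prod.ext (funext (Fintype.linearIndependent_iff.1 hy v h)) (Subtype.ext h1)
  have hsurj : Function.Surjective L := by
    intro x
    obtain ⟨u, hu, w, hw, rfl⟩ := Submodule.mem_sup.1 (hW.sup_eq_top ▸ Submodule.mem_top (x := x))
    obtain ⟨v, rfl⟩ := (Submodule.mem_span_range_iff_exists_fun ℝ).1 hu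
    exact ⟨(v, ⟨w, hw⟩), hLa _ _⟩
  exact ⟨W, (LinearEquiv.ofBijective L ⟨hinj, hsurj⟩).toContinuousLinearEquiv, hLa⟩

universe u in
/-- Local solvability of `D G (Y i) = A i ∘ G` for a flat system along independent vector fields
`Y i` closed under brackets. First integrals `H` of the system are constant along the
solution. -/
theorem exists_parallel_section {X F : Type u} [NormedAddCommGroup X] [NormedSpace ℝ X]
    [FiniteDimensional ℝ X] [NormedAddCommGroup F] [NormedSpace ℝ F] [CompleteSpace F]
    {F' : Type*} [NormedAddCommGroup F'] [NormedSpace ℝ F'] {k : ℕ}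
    {M : Set X} (hM : IsOpen M) {x₀ : X} (hx₀ : x₀ ∈ M)
    (Y : Fin k → X → X) (A : Fin k → X → F →L[ℝ] F)
    (hY : ∀ i, ContDiffOn ℝ ∞ (Y i) M) (hA : ∀ i, ContDiffOn ℝ ∞ (A i) M)
    (c : Fin k → Fin k → Fin k → ℝ)
    (hbrY : ∀ x ∈ M, ∀ i j,
      fderiv ℝ (Y j) x (Y i x) - fderiv ℝ (Y i) x (Y j x) = ∑ l, c i j l • Y l x)
    (hbrA : ∀ x ∈ M, ∀ i j g,
      fderiv ℝ (A j) x (Y i x) g + A j x (A i x g) -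
        (fderiv ℝ (A i) x (Y j x) g + A i x (A j x g)) = ∑ l, c i j l • A l x g)
    (hind : LinearIndependent ℝ fun i => Y i x₀) (g₀ : F)
    (H : F → F') (hH : Differentiable ℝ H)
    (hHA : ∀ x ∈ M, ∀ i g, fderiv ℝ H g (A i x g) = 0) :
    ∃ G : X → F, G x₀ = g₀ ∧ ∀ᶠ x in 𝓝 x₀, ContDiffAt ℝ ∞ G x ∧
      (∀ i, fderiv ℝ G x (Y i x) = A i x (G x)) ∧ H (G x) = H g₀ := by
  have : CompleteSpace X := FiniteDimensional.complete ℝ X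
  choose Y' hY's hY' using fun i => exists_contDiff_eventuallyEq hM (hY i) hx₀
  choose A' hA's hA' using fun i => exists_contDiff_eventuallyEq hM (hA i) hx₀
  set Z : Fin k → X × F → X × F := fun i z => (Y' i z.1, A' i z.1 z.2) with hZ
  have hZs : ∀ i, ContDiff ℝ ∞ (Z i) := fun i =>
    ((hY's i).comp contDiff_fst).prodMk (((hA's i).comp contDiff_fst).clm_apply contDiff_snd)
  have hZd : ∀ i z u, fderiv ℝ (Z i) z u =
      (fderiv ℝ (Y' i) z.1 u.1, fderiv ℝ (A' i) z.1 u.1 z.2 + A' i z.1 u.2) := by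
    intro i z u
    have h1 := ((hY's i).differentiable (by simp) z.1).hasFDerivAt.comp z
      (hasFDerivAt_fst (𝕜 := ℝ) (E := X) (F := F))
    have h2 := (((hA's i).differentiable (by simp) z.1).hasFDerivAt.comp z
      (hasFDerivAt_fst (𝕜 := ℝ) (E := X) (F := F))).clm_apply
        (hasFDerivAt_snd (𝕜 := ℝ) (E := X) (F := F) (p := z))
    have h3 : HasFDerivAt (Z i) _ z := h1.prodMk h2
    rw [h3.fderiv]
    simp [add_comm]
  have hYA : ∀ᶠ x in 𝓝 x₀, x ∈ M ∧ ∀ i, Y' i =ᶠ[𝓝 x] Y i ∧ A' i =ᶠ[𝓝 x] A i := by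
    refine Filter.Eventually.and (hM.mem_nhds hx₀) (eventually_all.2 fun i => ?_)
    exact (hY' i).eventually_nhds.and (hA' i).eventually_nhds
  set p : X × F := (x₀, g₀) with hp
  have hfst : Tendsto (Prod.fst : X × F → X) (𝓝 p) (𝓝 x₀) := continuous_fst.tendsto p
  have hbr : ∀ᶠ z in 𝓝 p, ∀ i j,
      fderiv ℝ (Z j) z (Z i z) - fderiv ℝ (Z i) z (Z j z) = ∑ l, c i j l • Z l z := by
    filter_upwards [hfst.eventually hYA] with z ⟨hzM, hz⟩ i j
    simp only [hZd]
    simp only [hZ, (hz _).1.fderiv_eq, (hz _).2.fderiv_eq, (hz _).1.eq_of_nhds,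
      (hz _).2.eq_of_nhds]
    refine Prod.ext ?_ ?_
    · simpa [Prod.fst_sum] using hbrY z.1 hzM i j
    · simpa [Prod.snd_sum] using hbrA z.1 hzM i j z.2
  obtain ⟨χ, φ, hχ0, hφ0, hχ⟩ := exists_canonical_coordinates Z hZs p c hbr
  obtain ⟨W, e, he⟩ := hind.exists_complement_equiv
  set β' : (Fin k → ℝ) × W →L[ℝ] (Fin k → ℝ) × (X × F) :=
    (ContinuousLinearMap.fst ℝ _ _).prod
      ((W.subtypeL.comp (ContinuousLinearMap.snd ℝ _ _)).prod 0) with hβ'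
  set β : (Fin k → ℝ) × W → (Fin k → ℝ) × (X × F) := fun q => (0, p) + β' q with hβ
  have hβs : ContDiff ℝ ∞ β := contDiff_const.add β'.contDiff
  have hβd : ∀ q, HasFDerivAt β β' q := fun q => β'.hasFDerivAt.const_add _
  have hβ0 : β 0 = (0, p) := by simp [hβ]
  have hβt : Tendsto β (𝓝 0) (𝓝 (0, p)) := hβ0 ▸ hβs.continuous.tendsto 0
  have hβv : ∀ v : Fin k → ℝ, β' (v, 0) = (v, 0) := fun v => by simp [hβ']
  have hβ1 : ∀ q, (β q).1 = q.1 := fun q => by simp [hβ, hβ']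
  have hχβ : ∀ᶠ q in 𝓝 (0 : (Fin k → ℝ) × W), ContDiffAt ℝ ∞ (χ ∘ β) q ∧
      ∀ v, fderiv ℝ (χ ∘ β) q (v, 0) = ∑ l, φ q.1 v l • Z l (χ (β q)) := by
    filter_upwards [hβt.eventually hχ] with q hq
    refine ⟨hq.1.comp q hβs.contDiffAt, fun v => ?_⟩
    rw [((hq.1.differentiableAt (by simp)).hasFDerivAt.comp q (hβd q)).fderiv,
      ContinuousLinearMap.comp_apply, hβv, hq.2, hβ1]
  have hχp : χ (0, p) = p := hχ0.self_of_nhds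
  set Ψ : (Fin k → ℝ) × W → X := fun q => (χ (β q)).1 with hΨ
  set Γ : (Fin k → ℝ) × W → F := fun q => (χ (β q)).2 with hΓ
  have hΨ0 : Ψ 0 = x₀ := by simp only [hΨ, hβ0, hχp]; rfl
  have hΨd : HasFDerivAt Ψ (e : (Fin k → ℝ) × W →L[ℝ] X) 0 := by
    have hχd : HasFDerivAt χ (fderiv ℝ χ (0, p)) (0, p) :=
      (hχ.self_of_nhds.1.differentiableAt (by simp)).hasFDerivAt
    have h1 : HasFDerivAt Ψ ((ContinuousLinearMap.fst ℝ X F).comp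
        ((fderiv ℝ χ (0, p)).comp β')) 0 := by
      refine hasFDerivAt_fst.comp 0 (HasFDerivAt.comp 0 ?_ (hβd 0))
      rwa [hβ0]
    have h2 : ∀ z, fderiv ℝ χ (0, p) (0, z) = z := by
      intro z
      have h3 : HasFDerivAt (fun z => χ (0, z))
          ((fderiv ℝ χ (0, p)).comp (ContinuousLinearMap.inr ℝ (Fin k → ℝ) (X × F))) p :=
        HasFDerivAt.comp p hχd (ContinuousLinearMap.inr ℝ (Fin k → ℝ) (X × F)).hasFDerivAt
      have h4 : HasFDerivAt (fun z => χ (0, z)) (ContinuousLinearMap.id ℝ (X × F)) p :=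
        (hasFDerivAt_id p).congr_of_eventuallyEq hχ0
      exact congrArg (fun L : X × F →L[ℝ] X × F => L z) (h3.unique h4)
    convert! h1 using 1
    refine ContinuousLinearMap.ext fun ⟨v, w⟩ => ?_
    have h5 : β' (v, w) = (v, 0) + (0, ((w : X), 0)) := by simp [hβ']
    rw [ContinuousLinearMap.comp_apply, ContinuousLinearMap.comp_apply, h5, map_add, h2,
      hχ.self_of_nhds.2]
    have h6 : ∀ l, Y' l p.1 = Y l x₀ := fun l => (hY' l).eq_of_nhds
    simp [he, hφ0, hχp, hZ, Prod.fst_sum, h6]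
  obtain ⟨θ, hθ0, hθs, hθl⟩ := exists_smooth_local_inverse (f := Ψ) e
    (hχβ.mono fun q hq => contDiffAt_fst.comp q hq.1) hΨd
  rw [hΨ0] at hθ0 hθs
  have hθt : Tendsto θ (𝓝 x₀) (𝓝 0) := by
    have := hθs.self_of_nhds.1.continuousAt
    rwa [ContinuousAt, hθ0] at this
  have hΨt : Tendsto Ψ (𝓝 0) (𝓝 x₀) := by
    have := hΨd.continuousAt
    rwa [ContinuousAt, hΨ0] at this
  have hΓs : ∀ᶠ q in 𝓝 (0 : (Fin k → ℝ) × W), ContDiffAt ℝ ∞ Γ q :=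
    hχβ.mono fun q hq => contDiffAt_snd.comp q hq.1
  have hdiff : ∀ᶠ q in 𝓝 (0 : (Fin k → ℝ) × W),
      (∀ v, fderiv ℝ Ψ q (v, 0) = ∑ l, φ q.1 v l • Y l (Ψ q)) ∧
      (∀ v, fderiv ℝ Γ q (v, 0) = ∑ l, φ q.1 v l • A l (Ψ q) (Γ q)) := by
    filter_upwards [hχβ, hΨt.eventually hYA] with q ⟨hqs, hqd⟩ ⟨_, hq⟩
    have h1 := (hqs.differentiableAt (by simp)).hasFDerivAt
    have hΨq : HasFDerivAt Ψ ((ContinuousLinearMap.fst ℝ X F).comp (fderiv ℝ (χ ∘ β) q)) q :=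
      hasFDerivAt_fst.comp q h1
    have hΓq : HasFDerivAt Γ ((ContinuousLinearMap.snd ℝ X F).comp (fderiv ℝ (χ ∘ β) q)) q :=
      hasFDerivAt_snd.comp q h1
    refine ⟨fun v => ?_, fun v => ?_⟩
    · rw [hΨq.fderiv, ContinuousLinearMap.comp_apply, hqd]
      simp only [← (hq _).1.eq_of_nhds]
      simp [hZ, hΨ]
    · rw [hΓq.fderiv, ContinuousLinearMap.comp_apply, hqd]
      simp only [← (hq _).2.eq_of_nhds]
      simp [hZ, hΨ, hΓ]
  have hconst : ∀ᶠ q in 𝓝 (0 : (Fin k → ℝ) × W), H (Γ q) = H g₀ := by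
    have h0 : ∀ᶠ w in 𝓝 (0 : W), Γ (0, w) = g₀ := by
      have h1 : Tendsto (fun w : W => (β (0, w)).2) (𝓝 0) (𝓝 p) := by
        have : Tendsto (fun w : W => ((0 : Fin k → ℝ), w)) (𝓝 0) (𝓝 0) :=
          (by fun_prop : Continuous fun w : W => ((0 : Fin k → ℝ), w)).tendsto 0
        exact (continuous_snd.tendsto (0, p)).comp (hβt.comp this)
      filter_upwards [h1.eventually hχ0] with w hw
      have h2 : β (0, w) = (0, (β (0, w)).2) := Prod.ext (hβ1 _) rfl
      simp only [hΓ]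
      rw [h2, hw]
      simp [hβ, hβ', hp]
    have h1 : ∀ᶠ q in 𝓝 (0 : (Fin k → ℝ) × W), DifferentiableAt ℝ (H ∘ Γ) q ∧
        ∀ v, fderiv ℝ (H ∘ Γ) q (v, 0) = 0 := by
      filter_upwards [hdiff, hΓs, hΨt.eventually hYA] with q hq hqs hqM
      have h2 := (hH (Γ q)).hasFDerivAt.comp q (hqs.differentiableAt (by simp)).hasFDerivAt
      refine ⟨h2.differentiableAt, fun v => ?_⟩
      rw [h2.fderiv, ContinuousLinearMap.comp_apply, hq.2 v, map_sum]
      simp [hHA _ hqM.1]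
    obtain ⟨δ, hδ, hball⟩ := Metric.eventually_nhds_iff_ball.1 h1
    have h2 : ∀ᶠ q in 𝓝 (0 : (Fin k → ℝ) × W), Γ (0, q.2) = g₀ :=
      (continuous_snd.tendsto (0 : (Fin k → ℝ) × W)).eventually h0
    filter_upwards [h2, Metric.ball_mem_nhds _ hδ] with ⟨t, w⟩ hw hq
    rw [← hw]
    have hmem : ∀ s ∈ Metric.ball (0 : Fin k → ℝ) δ,
        ((s, w) : (Fin k → ℝ) × W) ∈ Metric.ball 0 δ := by
      intro s hs
      rw [Metric.mem_ball, Prod.dist_eq] at hq ⊢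
      exact max_lt hs ((le_max_right _ _).trans_lt hq)
    have ht : t ∈ Metric.ball (0 : Fin k → ℝ) δ := by
      rw [Metric.mem_ball, Prod.dist_eq] at hq
      exact (le_max_left _ _).trans_lt hq
    have hd : ∀ s ∈ Metric.ball (0 : Fin k → ℝ) δ,
        HasFDerivAt (fun s => H (Γ (s, w))) (0 : (Fin k → ℝ) →L[ℝ] F') s := by
      intro s hs
      obtain ⟨h3, h4⟩ := hball _ (hmem s hs)
      have h5 := h3.hasFDerivAt.comp s (hasFDerivAt_prodMk_left (𝕜 := ℝ) s w)
      convert! h5 using 1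
      exact ContinuousLinearMap.ext fun v => (h4 v).symm
    exact (convex_ball (0 : Fin k → ℝ) δ).is_const_of_fderivWithin_eq_zero (𝕜 := ℝ)
      (fun s hs => (hd s hs).differentiableAt.differentiableWithinAt)
      (fun s hs => by
        rw [fderivWithin_of_isOpen Metric.isOpen_ball hs, (hd s hs).fderiv])
      ht (Metric.mem_ball_self hδ)
  refine ⟨Γ ∘ θ, by simp only [Function.comp_apply, hθ0, hΓ, hβ0, hχp]; rfl, ?_⟩
  filter_upwards [hθs, hθt.eventually hΓs, hθt.eventually hdiff, hθt.eventually hθl,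
    hθt.eventually hconst] with x hxs hxΓ hxd hxl hxc
  refine ⟨hxΓ.comp x hxs.1, fun i => ?_, hxc⟩
  have hinj : Function.Injective (φ (θ x).1) := by
    rw [injective_iff_map_eq_zero]
    intro v hv
    have h1 := hxl.2 (v, 0)
    rw [hxd.1 v, hv] at h1
    simpa using (congrArg Prod.fst h1).symm
  obtain ⟨v, hv⟩ := LinearMap.injective_iff_surjective (f := (φ (θ x).1).toLinearMap) |>.1 hinj
    (Pi.single i 1)
  replace hv : φ (θ x).1 v = Pi.single i 1 := hv
  have h1 := hxl.2 (v, 0)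
  have h2 := hxd.2 v
  rw [hxd.1 v, hv, hxs.2] at h1
  rw [hv, hxs.2] at h2
  simp only [Pi.single_apply, ite_smul, one_smul, zero_smul, Finset.sum_ite_eq',
    Finset.mem_univ, if_true] at h1 h2
  rw [((hxΓ.differentiableAt (by simp)).hasFDerivAt.comp x
    (hxs.1.differentiableAt (by simp)).hasFDerivAt).fderiv, ContinuousLinearMap.comp_apply, h1, h2]
  rfl

end

section

open Set Filter Topology
open scoped ContDiff

theorem vfApp_eq_fderiv {d : ℕ} (Y : (Fin d → ℝ) → Fin d → ℝ) (f : (Fin d → ℝ) → ℝ)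
    (x : Fin d → ℝ) : vfApp Y f x = fderiv ℝ f x (Y x) := by
  conv_rhs => rw [pi_eq_sum_univ' (Y x)]
  simp only [map_sum, map_smul, smul_eq_mul, vfApp, pd]

theorem fderiv_component {E ι : Type*} [NormedAddCommGroup E] [NormedSpace ℝ E] [Fintype ι]
    {F : Type*} [NormedAddCommGroup F] [NormedSpace ℝ F] {f : E → ι → F} {x : E}
    (hf : DifferentiableAt ℝ f x) (i : ι) (v : E) :
    fderiv ℝ (fun y => f y i) x v = fderiv ℝ f x v i := by
  rw [(hasFDerivAt_pi'.1 hf.hasFDerivAt i).fderiv]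
  rfl

theorem fderiv_component₂ {E ι κ : Type*} [NormedAddCommGroup E] [NormedSpace ℝ E] [Fintype ι]
    [Fintype κ] {f : E → ι → κ → ℝ} {x : E}
    (hf : DifferentiableAt ℝ f x) (i : ι) (j : κ) (v : E) :
    fderiv ℝ (fun y => f y i j) x v = fderiv ℝ f x v i j := by
  rw [fderiv_component (f := fun y => f y i) (differentiableAt_pi.1 hf i), fderiv_component hf]

theorem vfBracket_eq_fderiv {d : ℕ} {X Y : (Fin d → ℝ) → Fin d → ℝ} {x : Fin d → ℝ}
    (hX : DifferentiableAt ℝ X x) (hY : DifferentiableAt ℝ Y x) :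
    vfBracket X Y x = fderiv ℝ Y x (X x) - fderiv ℝ X x (Y x) := by
  ext i
  rw [Pi.sub_apply, ← fderiv_component hX, ← fderiv_component hY, ← vfApp_eq_fderiv,
    ← vfApp_eq_fderiv]
  simp [vfBracket, vfApp, Finset.sum_sub_distrib]

theorem mixBracket_eq_vfApp {d m : ℕ} (H : (Fin d → ℝ) → Fin d → ℝ)
    (K : (Fin d → ℝ) → Fin d → Fin m → ℝ) (x : Fin d → ℝ) (i : Fin d) (j : Fin m) :
    mixBracket H K x i j =
      vfApp H (fun y => K y i j) x - ∑ k, K x k j * pd (fun y => H y i) k x := by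
  simp [mixBracket, vfApp, Finset.sum_sub_distrib]

theorem pd_coord {d : ℕ} (i j : Fin d) (x : Fin d → ℝ) :
    pd (fun z => z i) j x = if i = j then 1 else 0 := by
  have : HasFDerivAt (fun z : Fin d → ℝ => z i)
      (ContinuousLinearMap.proj (R := ℝ) (φ := fun _ : Fin d => ℝ) i) x :=
    (ContinuousLinearMap.proj (R := ℝ) (φ := fun _ : Fin d => ℝ) i).hasFDerivAt
  simp [pd, this.fderiv, Pi.single_apply]

theorem gen_coord {d m : ℕ} (μ : (Fin d → ℝ) → Fin d → ℝ)
    (σ : (Fin d → ℝ) → Fin d → Fin m → ℝ) (i : Fin d) (x : Fin d → ℝ) :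
    gen μ σ (fun z => z i) x = μ x i := by
  have h : ∀ (c : ℝ) (j : Fin d), pd (fun _ => c) j x = 0 := fun c j => by simp [pd]
  simp [gen, pd_coord, h]

theorem transMu_id {d m : ℕ} (μ : (Fin d → ℝ) → Fin d → ℝ)
    (σ : (Fin d → ℝ) → Fin d → Fin m → ℝ) (η : (Fin d → ℝ) → ℝ) :
    transMu μ σ id id η = fun y i => 1 / η y * μ y i := by
  ext y i
  simp [transMu, gen_coord]

theorem transSigma_id {d m : ℕ} (σ : (Fin d → ℝ) → Fin d → Fin m → ℝ)
    (B : (Fin d → ℝ) → Fin m → Fin m → ℝ) (η : (Fin d → ℝ) → ℝ) :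
    transSigma σ id id B η =
      fun y i a => 1 / Real.sqrt (η y) * ∑ b, σ y i b * B y a b := by
  ext y i a
  simp [transSigma, pd_coord]

theorem pushVF_id {d : ℕ} (Y : (Fin d → ℝ) → Fin d → ℝ) : pushVF id id Y = Y := by
  ext y i
  simp [pushVF, pd_coord]

/-- Orthogonal matrices preserve the dot product. -/
theorem sum_mul_sum_of_orthogonal {m : ℕ} {B : Fin m → Fin m → ℝ}
    (hB : ∀ a b, ∑ e, B a e * B b e = if a = b then (1 : ℝ) else 0) (u w : Fin m → ℝ) :
    ∑ a, (∑ b, u b * B a b) * (∑ b, w b * B a b) = ∑ b, u b * w b := by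
  have h1 : Matrix.of B * (Matrix.of B).transpose = 1 := by
    ext a b
    simpa [Matrix.mul_apply, Matrix.one_apply] using hB a b
  have h2 : (Matrix.of B).transpose * Matrix.of B = 1 := mul_eq_one_comm.1 h1
  have h3 : ∀ u : Fin m → ℝ, (fun a => ∑ b, u b * B a b) = (Matrix.of B).mulVec u := fun u => by
    ext a
    simp [Matrix.mulVec, dotProduct, mul_comm]
  calc ∑ a, (∑ b, u b * B a b) * (∑ b, w b * B a b)
      = (Matrix.of B).mulVec u ⬝ᵥ (Matrix.of B).mulVec w := by rw [← h3, ← h3]; rfl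
    _ = u ⬝ᵥ w := by
      rw [Matrix.dotProduct_mulVec, Matrix.vecMul_mulVec, h2, Matrix.vecMul_one]
    _ = ∑ b, u b * w b := rfl

/-- A symmetry becomes strong after the rotation `B` and the time change `η` that solve
`Y(B) = -B·C` and `Y(η) = -τη`. -/
theorem IsSymmetry.strong_of_gauge {d m : ℕ} {U : Set (Fin d → ℝ)}
    {μ : (Fin d → ℝ) → Fin d → ℝ} {σ : (Fin d → ℝ) → Fin d → Fin m → ℝ}
    {Y : (Fin d → ℝ) → Fin d → ℝ} {C : (Fin d → ℝ) → Fin m → Fin m → ℝ}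
    {τ η : (Fin d → ℝ) → ℝ} {B : (Fin d → ℝ) → Fin m → Fin m → ℝ}
    (hsym : IsSymmetry U μ σ Y C τ)
    (hμ : ∀ x ∈ U, DifferentiableAt ℝ μ x) (hσ : ∀ x ∈ U, DifferentiableAt ℝ σ x)
    (hBd : ∀ x ∈ U, DifferentiableAt ℝ B x) (hηd : ∀ x ∈ U, DifferentiableAt ℝ η x)
    (hC : ∀ x ∈ U, ∀ a b, C x a b = - C x b a)
    (hBo : ∀ x ∈ U, ∀ a b, ∑ e, B x a e * B x b e = if a = b then (1 : ℝ) else 0)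
    (hη : ∀ x ∈ U, 0 < η x)
    (hYB : ∀ x ∈ U, ∀ a b, vfApp Y (fun y => B y a b) x = - ∑ e, B x a e * C x e b)
    (hYη : ∀ x ∈ U, vfApp Y η x = - τ x * η x)
    {C' : (Fin d → ℝ) → Fin m → Fin m → ℝ} {τ' : (Fin d → ℝ) → ℝ}
    (hC' : ∀ x ∈ U, ∀ a b, C' x a b = 0) (hτ' : ∀ x ∈ U, τ' x = 0) :
    IsSymmetry U (fun y i => 1 / η y * μ y i)
      (fun y i a => 1 / Real.sqrt (η y) * ∑ b, σ y i b * B y a b) Y C' τ' := by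
  refine ⟨fun x hx i a => ?_, fun x hx i => ?_⟩
  · have hs : HasFDerivAt (fun y => 1 / Real.sqrt (η y))
        ((-(1 / 2) / (η x * Real.sqrt (η x)) : ℝ) • fderiv ℝ η x) x := by
      have h1 := ((hηd x hx).hasFDerivAt.sqrt (hη x hx).ne')
      have h2 := (hasDerivAt_inv (Real.sqrt_pos.2 (hη x hx)).ne').comp_hasFDerivAt x h1
      simp only [one_div]
      convert! h2 using 1
      rw [smul_smul, Real.sq_sqrt (hη x hx).le]
      congr 1
      field_simp
    have hσb : ∀ b, HasFDerivAt (fun y => σ y i b) (fderiv ℝ (fun y => σ y i b) x) x := fun b =>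
      (differentiableAt_pi.1 (differentiableAt_pi.1 (hσ x hx) i) b).hasFDerivAt
    have hBb : ∀ b, HasFDerivAt (fun y => B y a b) (fderiv ℝ (fun y => B y a b) x) x := fun b =>
      (differentiableAt_pi.1 (differentiableAt_pi.1 (hBd x hx) a) b).hasFDerivAt
    have hd : HasFDerivAt (fun y => 1 / Real.sqrt (η y) * ∑ b, σ y i b * B y a b) _ x :=
      hs.mul (HasFDerivAt.fun_sum (u := Finset.univ) fun b _ => (hσb b).mul (hBb b))
    have hσ1 : ∀ b, vfApp Y (fun y => σ y i b) x = ∑ k, σ x k b * pd (fun y => Y y i) k x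
        - (1 / 2) * τ x * σ x i b - ∑ e, σ x i e * C x e b := fun b => by
      have := hsym.1 x hx i b
      rw [mixBracket_eq_vfApp] at this
      linarith
    rw [mixBracket_eq_vfApp, vfApp_eq_fderiv, hd.fderiv]
    simp only [add_apply, smul_apply,
      sum_apply, ← vfApp_eq_fderiv, hYB x hx, hYη x hx, hσ1, smul_eq_mul,
      hC' x hx, hτ' x hx]
    have e1 : ∑ b, σ x i b * -(∑ e, B x a e * C x e b) = ∑ b, B x a b * ∑ e, σ x i e * C x e b := by
      simp only [Finset.mul_sum, ← Finset.sum_neg_distrib]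
      rw [Finset.sum_comm]
      refine Finset.sum_congr rfl fun b _ => Finset.sum_congr rfl fun e _ => ?_
      rw [hC x hx b e]
      ring
    have e2 : ∑ k, 1 / Real.sqrt (η x) * (∑ b, σ x k b * B x a b) * pd (fun y => Y y i) k x =
        1 / Real.sqrt (η x) * ∑ b, B x a b * ∑ k, σ x k b * pd (fun y => Y y i) k x := by
      simp only [Finset.mul_sum, Finset.sum_mul]
      rw [Finset.sum_comm]
      refine Finset.sum_congr rfl fun b _ => Finset.sum_congr rfl fun k _ => ?_
      ring
    have e3 : ∑ b, B x a b * (1 / 2 * τ x * σ x i b) = 1 / 2 * τ x * ∑ b, σ x i b * B x a b := by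
      rw [Finset.mul_sum]
      exact Finset.sum_congr rfl fun b _ => by ring
    rw [e2]
    simp only [mul_sub, Finset.sum_add_distrib, Finset.sum_sub_distrib, e1, e3]
    have := (hη x hx).ne'
    have := (Real.sqrt_pos.2 (hη x hx)).ne'
    simp only [mul_zero, Finset.sum_const_zero]
    field_simp
    ring
  · have hd : HasFDerivAt (fun y => (η y)⁻¹ * μ y i) _ x :=
      ((hasDerivAt_inv (hη x hx).ne').comp_hasFDerivAt x (hηd x hx).hasFDerivAt).mul
        (differentiableAt_pi.1 (hμ x hx) i).hasFDerivAt
    have h1 : vfApp Y (fun y => 1 / η y * μ y i) x =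
        1 / η x * (vfApp Y (fun y => μ y i) x + τ x * μ x i) := by
      simp only [one_div]
      rw [vfApp_eq_fderiv, hd.fderiv]
      simp only [add_apply, smul_apply,
        ← vfApp_eq_fderiv, hYη x hx, smul_eq_mul, Function.comp_apply]
      have := (hη x hx).ne'
      field_simp
    have h2 : gen (fun y i => 1 / η y * μ y i)
        (fun y i a => 1 / Real.sqrt (η y) * ∑ b, σ y i b * B y a b) (fun y => Y y i) x =
        1 / η x * gen μ σ (fun y => Y y i) x := by
      have h3 : ∀ p q, ∑ a, (1 / Real.sqrt (η x) * ∑ b, σ x p b * B x a b) *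
          (1 / Real.sqrt (η x) * ∑ b, σ x q b * B x a b) = 1 / η x * ∑ b, σ x p b * σ x q b := by
        intro p q
        rw [← sum_mul_sum_of_orthogonal (hBo x hx) (σ x p), Finset.mul_sum]
        refine Finset.sum_congr rfl fun a _ => ?_
        rw [mul_mul_mul_comm, div_mul_div_comm, one_mul, Real.mul_self_sqrt (hη x hx).le]
      have h4 : ∀ (s : Fin d → Fin m → ℝ) (D : Fin d → Fin d → ℝ),
          ∑ α, ∑ i, ∑ j, s i α * s j α * D i j = ∑ i, ∑ j, (∑ α, s i α * s j α) * D i j := by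
        intro s D
        simp only [Finset.sum_mul]
        rw [Finset.sum_comm]
        exact Finset.sum_congr rfl fun i _ => Finset.sum_comm
      simp only [gen, h4 (fun i a => 1 / Real.sqrt (η x) * ∑ b, σ x i b * B x a b)
        fun p q => pd (fun y => pd (fun y => Y y i) q y) p x, h3, h4 (σ x)
        fun p q => pd (fun y => pd (fun y => Y y i) q y) p x]
      simp only [mul_add, Finset.mul_sum, Finset.sum_mul]
      congr 1
      · simp only [mul_assoc, mul_left_comm]
      · simp only [mul_assoc]
    have h5 := hsym.2 x hx i
    simp only [h1, h2, hτ' x hx]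
    linear_combination (1 / η x) * h5

/-- The map `C ↦ (g ↦ -g·C)` on square matrices. -/
def negMulRightL (m : ℕ) :
    (Fin m → Fin m → ℝ) →L[ℝ] (Fin m → Fin m → ℝ) →L[ℝ] Fin m → Fin m → ℝ :=
  LinearMap.toContinuousBilinearMap <| LinearMap.mk₂ ℝ
    (fun C g a b => -∑ e, g a e * C e b)
    (fun C C' g => by ext a b; simp [mul_add, Finset.sum_add_distrib, add_comm])
    (fun r C g => by ext a b; simp [Finset.mul_sum, mul_left_comm])
    (fun C g g' => by ext a b; simp [add_mul, Finset.sum_add_distrib, add_comm])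
    (fun r C g => by ext a b; simp [Finset.mul_sum, mul_assoc])

theorem negMulRightL_apply {m : ℕ} (C g : Fin m → Fin m → ℝ) (a b : Fin m) :
    negMulRightL m C g a b = -∑ e, g a e * C e b := rfl

theorem negMulRightL_comp {m : ℕ} (C C' g : Fin m → Fin m → ℝ) :
    negMulRightL m C (negMulRightL m C' g) =
      negMulRightL m (fun a b => -∑ e, C' a e * C e b) g := by
  ext a b
  simp only [negMulRightL_apply, Finset.mul_sum, Finset.sum_mul, neg_mul, mul_neg,
    Finset.sum_neg_distrib]
  rw [Finset.sum_comm]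
  simp only [mul_assoc]

/-- A rotation-valued solution of `Y i (B) = -B·C i`, for a flat family of antisymmetric `C i`. -/
theorem exists_rotation_gauge {n m k : ℕ} {M : Set (Fin n → ℝ)} (hM : IsOpen M)
    {x₀ : Fin n → ℝ} (hx₀ : x₀ ∈ M)
    (Y : Fin k → (Fin n → ℝ) → Fin n → ℝ) (C : Fin k → (Fin n → ℝ) → Fin m → Fin m → ℝ)
    (hY : ∀ i, ContDiffOn ℝ ∞ (Y i) M) (hC : ∀ i, ContDiffOn ℝ ∞ (C i) M)
    (hCso : ∀ i, ∀ x ∈ M, ∀ a b, C i x a b = - C i x b a)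
    (c : Fin k → Fin k → Fin k → ℝ)
    (hbrY : ∀ i j, ∀ x ∈ M, vfBracket (Y i) (Y j) x = ∑ l, c i j l • Y l x)
    (hbrC : ∀ i j, ∀ x ∈ M, ∀ a b,
      vfApp (Y i) (fun y => C j y a b) x - vfApp (Y j) (fun y => C i y a b) x
        - (∑ e, (C i x a e * C j x e b - C j x a e * C i x e b))
      = ∑ l, c i j l * C l x a b)
    (hind : LinearIndependent ℝ fun i => Y i x₀) :
    ∃ B : (Fin n → ℝ) → Fin m → Fin m → ℝ, ∀ᶠ x in 𝓝 x₀, ContDiffAt ℝ ∞ B x ∧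
      (∀ i a b, vfApp (Y i) (fun y => B y a b) x = -∑ e, B x a e * C i x e b) ∧
      (∀ a b, ∑ e, B x a e * B x b e = if a = b then (1 : ℝ) else 0) ∧
      Matrix.det (Matrix.of (B x)) = 1 := by
  have hYd : ∀ i, ∀ x ∈ M, DifferentiableAt ℝ (Y i) x := fun i x hx =>
    ((hY i).contDiffAt (hM.mem_nhds hx)).differentiableAt (by simp)
  have hCd : ∀ i, ∀ x ∈ M, DifferentiableAt ℝ (C i) x := fun i x hx =>
    ((hC i).contDiffAt (hM.mem_nhds hx)).differentiableAt (by simp)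
  set g₀ : Fin m → Fin m → ℝ := fun a b => if a = b then 1 else 0 with hg₀
  set H : (Fin m → Fin m → ℝ) → Fin m → Fin m → ℝ := fun g a b => ∑ e, g a e * g b e with hH
  have hHd : ∀ g v a b, HasFDerivAt (fun g => H g a b) (fderiv ℝ (fun g => H g a b) g) g ∧
      fderiv ℝ (fun g => H g a b) g v = ∑ e, (g a e * v b e + v a e * g b e) := by
    intro g v a b
    have hp : ∀ a e, HasFDerivAt (fun g : Fin m → Fin m → ℝ => g a e)
        ((ContinuousLinearMap.proj (R := ℝ) (φ := fun _ : Fin m => ℝ) e).comp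
          (ContinuousLinearMap.proj (R := ℝ) (φ := fun _ : Fin m => Fin m → ℝ) a)) g := fun a e =>
      ((ContinuousLinearMap.proj (R := ℝ) (φ := fun _ : Fin m => ℝ) e).comp
        (ContinuousLinearMap.proj (R := ℝ) (φ := fun _ : Fin m => Fin m → ℝ) a)).hasFDerivAt
    have h : HasFDerivAt (fun g => H g a b) _ g :=
      HasFDerivAt.fun_sum (u := Finset.univ) fun e _ => (hp a e).mul (hp b e)
    refine ⟨h.differentiableAt.hasFDerivAt, ?_⟩
    rw [h.fderiv]
    simp [sum_apply, mul_comm]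
  have hHdiff : Differentiable ℝ H := fun g =>
    differentiableAt_pi.2 fun a => differentiableAt_pi.2 fun b =>
      (hHd g 0 a b).1.differentiableAt
  have hA : ∀ i, ∀ x ∈ M, ∀ v, fderiv ℝ (fun x => negMulRightL m (C i x)) x v =
      negMulRightL m (fderiv ℝ (C i) x v) := fun i x hx v => by
    have h : HasFDerivAt (fun x => negMulRightL m (C i x)) _ x :=
      (negMulRightL m).hasFDerivAt.comp x (hCd i x hx).hasFDerivAt
    rw [h.fderiv]
    rfl
  obtain ⟨B, hB0, hB⟩ := exists_parallel_section hM hx₀ Y (fun i x => negMulRightL m (C i x)) hY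
    (fun i => (negMulRightL m).contDiff.comp_contDiffOn (hC i)) c
    (fun x hx i j => by rw [← vfBracket_eq_fderiv (hYd i x hx) (hYd j x hx), hbrY i j x hx])
    (fun x hx i j g => by
      simp only [hA _ x hx, negMulRightL_comp]
      have hl : ∑ l, c i j l • negMulRightL m (C l x) g =
          negMulRightL m (∑ l, c i j l • C l x) g := by
        simp [map_sum, sum_apply]
      rw [hl, ← add_apply, ← add_apply, ← map_add, ← map_add, ← sub_apply, ← map_sub]
      congr 2
      ext a b
      have h := hbrC i j x hx a b
      rw [vfApp_eq_fderiv, vfApp_eq_fderiv, fderiv_component₂ (hCd j x hx),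
        fderiv_component₂ (hCd i x hx)] at h
      simp only [Pi.sub_apply, Pi.add_apply, Finset.sum_apply, Pi.smul_apply, smul_eq_mul, ← h,
        Finset.sum_sub_distrib]
      ring)
    hind g₀ H hHdiff
    (fun x hx i g => by
      ext a b
      rw [← fderiv_component₂ (hHdiff g), (hHd g _ a b).2]
      simp only [negMulRightL_apply, Finset.sum_add_distrib, mul_neg, neg_mul, Finset.mul_sum,
        Finset.sum_mul, Finset.sum_neg_distrib, Pi.zero_apply]
      rw [Finset.sum_comm, ← neg_add, ← Finset.sum_add_distrib, neg_eq_zero]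
      refine Finset.sum_eq_zero fun e _ => ?_
      rw [← Finset.sum_add_distrib]
      refine Finset.sum_eq_zero fun f _ => ?_
      rw [hCso i x hx f e]
      ring)
  have hdet : ∀ᶠ x in 𝓝 x₀, 0 < Matrix.det (Matrix.of (B x)) := by
    have h1 : ContinuousAt (fun x => Matrix.det (Matrix.of (B x))) x₀ :=
      (Continuous.matrix_det continuous_id).continuousAt.comp hB.self_of_nhds.1.continuousAt
    refine h1.eventually (lt_mem_nhds ?_)
    have h2 : Matrix.of g₀ = (1 : Matrix (Fin m) (Fin m) ℝ) := by
      ext a b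
      simp [hg₀, Matrix.one_apply]
    simp only [hB0, h2, Matrix.det_one]
    exact one_pos
  refine ⟨B, ?_⟩
  filter_upwards [hB, hdet, hM.mem_nhds hx₀] with x hx hpos hxM
  have hBd := hx.1.differentiableAt (by simp)
  have hBo : ∀ a b, ∑ e, B x a e * B x b e = if a = b then (1 : ℝ) else 0 := fun a b => by
    have h := congrFun (congrFun hx.2.2 a) b
    simpa [hH, hg₀] using h
  refine ⟨hx.1, fun i a b => ?_, hBo, ?_⟩
  · rw [vfApp_eq_fderiv, fderiv_component₂ hBd, hx.2.1 i, negMulRightL_apply]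
  · have h1 : Matrix.of (B x) * (Matrix.of (B x)).transpose = 1 := by
      ext a b
      simpa [Matrix.mul_apply, Matrix.one_apply] using hBo a b
    have h2 := congrArg Matrix.det h1
    rw [Matrix.det_mul, Matrix.det_transpose, Matrix.det_one] at h2
    nlinarith

/-- A positive solution of `Y i (η) = -τ i η`, for a flat family `τ i`. -/
theorem exists_scaling_gauge {n k : ℕ} {M : Set (Fin n → ℝ)} (hM : IsOpen M)
    {x₀ : Fin n → ℝ} (hx₀ : x₀ ∈ M)
    (Y : Fin k → (Fin n → ℝ) → Fin n → ℝ) (τ : Fin k → (Fin n → ℝ) → ℝ)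
    (hY : ∀ i, ContDiffOn ℝ ∞ (Y i) M) (hτ : ∀ i, ContDiffOn ℝ ∞ (τ i) M)
    (c : Fin k → Fin k → Fin k → ℝ)
    (hbrY : ∀ i j, ∀ x ∈ M, vfBracket (Y i) (Y j) x = ∑ l, c i j l • Y l x)
    (hbrτ : ∀ i j, ∀ x ∈ M,
      vfApp (Y i) (τ j) x - vfApp (Y j) (τ i) x = ∑ l, c i j l * τ l x)
    (hind : LinearIndependent ℝ fun i => Y i x₀) :
    ∃ η : (Fin n → ℝ) → ℝ, ∀ᶠ x in 𝓝 x₀, ContDiffAt ℝ ∞ η x ∧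
      (∀ i, vfApp (Y i) η x = -τ i x * η x) ∧ 0 < η x := by
  have hYd : ∀ i, ∀ x ∈ M, DifferentiableAt ℝ (Y i) x := fun i x hx =>
    ((hY i).contDiffAt (hM.mem_nhds hx)).differentiableAt (by simp)
  have hA : ∀ i, ∀ x ∈ M, ∀ v g,
      fderiv ℝ (fun x => -τ i x • ContinuousLinearMap.id ℝ ℝ) x v g = -fderiv ℝ (τ i) x v * g :=
    fun i x hx v g => by
      have h := ((hτ i).contDiffAt (hM.mem_nhds hx)).differentiableAt (by simp)
      rw [(h.hasFDerivAt.fun_neg.smul_const (ContinuousLinearMap.id ℝ ℝ)).fderiv]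
      simp
  obtain ⟨η, hη0, hη⟩ := exists_parallel_section hM hx₀ Y
    (fun i x => -τ i x • ContinuousLinearMap.id ℝ ℝ) hY
    (fun i => (hτ i).neg.smul contDiffOn_const) c
    (fun x hx i j => by rw [← vfBracket_eq_fderiv (hYd i x hx) (hYd j x hx), hbrY i j x hx])
    (fun x hx i j g => by
      simp only [hA _ x hx, smul_apply, ContinuousLinearMap.id_apply, smul_eq_mul]
      simp only [← vfApp_eq_fderiv, ← mul_assoc, ← Finset.sum_mul, mul_neg, neg_mul,
        Finset.sum_neg_distrib]
      rw [← hbrτ i j x hx]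
      ring)
    hind 1 (fun _ => (0 : ℝ)) (differentiable_const _) (fun x hx i g => by simp)
  have hpos : ∀ᶠ x in 𝓝 x₀, 0 < η x :=
    hη.self_of_nhds.1.continuousAt.eventually (lt_mem_nhds (by rw [hη0]; exact one_pos))
  refine ⟨η, ?_⟩
  filter_upwards [hη, hpos] with x hx hxpos
  exact ⟨hx.1, fun i => by rw [vfApp_eq_fderiv, hx.2.1 i]; simp, hxpos⟩

end

/-- Corollary 3.6.  If `V_1,…,V_k` are infinitesimal symmetries of `(μ,σ)`
spanning a Lie algebra and `Y_1(x₀),…,Y_k(x₀)` are linearly independent, then there are a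
neighborhood `U` of `x₀` and a stochastic transformation `T = (Φ,B,η)` on `U` such that the
push-forwards `T_*(V_i)` are strong infinitesimal symmetries of `E_T(μ,σ)`. -/
theorem symmetries_to_strong_symmetries
    {n m k : ℕ}
    (M : Set (Fin n → ℝ)) (hMopen : IsOpen M)
    (μ : (Fin n → ℝ) → Fin n → ℝ) (σ : (Fin n → ℝ) → Fin n → Fin m → ℝ)
    (hμsmooth : ContDiffOn ℝ (⊤ : ℕ∞) μ M) (hσsmooth : ContDiffOn ℝ (⊤ : ℕ∞) σ M)
    (Y : Fin k → (Fin n → ℝ) → Fin n → ℝ)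
    (C : Fin k → (Fin n → ℝ) → Fin m → Fin m → ℝ)
    (τ : Fin k → (Fin n → ℝ) → ℝ)
    (hYsmooth : ∀ i, ContDiffOn ℝ (⊤ : ℕ∞) (Y i) M)
    (hCsmooth : ∀ i, ContDiffOn ℝ (⊤ : ℕ∞) (C i) M)
    (hτsmooth : ∀ i, ContDiffOn ℝ (⊤ : ℕ∞) (τ i) M)
    (hCso : ∀ i, ∀ x ∈ M, ∀ a b, C i x a b = - C i x b a)
    (hsym : ∀ i, IsSymmetry M μ σ (Y i) (C i) (τ i))
    -- the symmetries span a Lie algebra under the bracket of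
    -- infinitesimal stochastic transformations
    (c : Fin k → Fin k → Fin k → ℝ)
    (hbrY : ∀ i j, ∀ x ∈ M, vfBracket (Y i) (Y j) x = ∑ l, c i j l • Y l x)
    (hbrC : ∀ i j, ∀ x ∈ M, ∀ a b,
      vfApp (Y i) (fun y => C j y a b) x - vfApp (Y j) (fun y => C i y a b) x
        - (∑ e, (C i x a e * C j x e b - C j x a e * C i x e b))
      = ∑ l, c i j l * C l x a b)
    (hbrτ : ∀ i j, ∀ x ∈ M,
      vfApp (Y i) (τ j) x - vfApp (Y j) (τ i) x = ∑ l, c i j l * τ l x)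
    (x₀ : Fin n → ℝ) (hx₀ : x₀ ∈ M)
    (hindep : LinearIndependent ℝ (fun i => Y i x₀)) :
    ∃ U : Set (Fin n → ℝ), IsOpen U ∧ x₀ ∈ U ∧ U ⊆ M ∧
    ∃ (U' : Set (Fin n → ℝ)) (Φ Φinv : (Fin n → ℝ) → Fin n → ℝ)
      (B : (Fin n → ℝ) → Fin m → Fin m → ℝ) (η : (Fin n → ℝ) → ℝ),
      IsOpen U' ∧ Φ '' U = U' ∧
      ContDiffOn ℝ (⊤ : ℕ∞) Φ U ∧ ContDiffOn ℝ (⊤ : ℕ∞) Φinv U' ∧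
      (∀ x ∈ U, Φinv (Φ x) = x) ∧ (∀ y ∈ U', Φ (Φinv y) = y) ∧
      ContDiffOn ℝ (⊤ : ℕ∞) B U ∧ ContDiffOn ℝ (⊤ : ℕ∞) η U ∧
      (∀ x ∈ U, ∀ a b, ∑ e, B x a e * B x b e = if a = b then (1:ℝ) else 0) ∧
      (∀ x ∈ U, Matrix.det (Matrix.of (B x)) = 1) ∧
      (∀ x ∈ U, 0 < η x) ∧
      ∀ i : Fin k,
        -- `T_*(V_i)` is strong …
        (∀ y ∈ U', ∀ a b, pushC Φinv B (Y i) (C i) y a b = 0) ∧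
        (∀ y ∈ U', pushTau Φinv (Y i) η (τ i) y = 0) ∧
        -- … and is a symmetry of the transformed SDE `E_T(μ,σ)`
        IsSymmetry U' (transMu μ σ Φ Φinv η) (transSigma σ Φ Φinv B η)
          (pushVF Φ Φinv (Y i)) (pushC Φinv B (Y i) (C i))
          (pushTau Φinv (Y i) η (τ i)) := by
  obtain ⟨B, hB⟩ := exists_rotation_gauge hMopen hx₀ Y C hYsmooth hCsmooth hCso c hbrY hbrC hindep
  obtain ⟨η, hη⟩ := exists_scaling_gauge hMopen hx₀ Y τ hYsmooth hτsmooth c hbrY hbrτ hindep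
  obtain ⟨U, hU, hUopen, hxU⟩ := eventually_nhds_iff.1
    ((hB.and hη).and (hMopen.eventually_mem hx₀))
  have hUM : U ⊆ M := fun x hx => (hU x hx).2
  have hdiff : ∀ {p : ℕ} {E : Type} [NormedAddCommGroup E] [NormedSpace ℝ E]
      {f : (Fin p → ℝ) → E} {N : Set (Fin p → ℝ)}, IsOpen N → ContDiffOn ℝ (⊤ : ℕ∞) f N →
      ∀ x ∈ N, DifferentiableAt ℝ f x := fun hN hf x hx =>
    (hf.contDiffAt (hN.mem_nhds hx)).differentiableAt (by simp)
  have hBs : ContDiffOn ℝ (⊤ : ℕ∞) B U := fun x hx => (hU x hx).1.1.1.contDiffWithinAt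
  have hηs : ContDiffOn ℝ (⊤ : ℕ∞) η U := fun x hx => (hU x hx).1.2.1.contDiffWithinAt
  have hBo : ∀ x ∈ U, ∀ a b, ∑ e, B x a e * B x b e = if a = b then (1 : ℝ) else 0 :=
    fun x hx => (hU x hx).1.1.2.2.1
  have hηp : ∀ x ∈ U, 0 < η x := fun x hx => (hU x hx).1.2.2.2
  refine ⟨U, hUopen, hxU, hUM, U, id, id, B, η, hUopen, Set.image_id U, contDiffOn_id,
    contDiffOn_id, fun _ _ => rfl, fun _ _ => rfl, hBs, hηs, hBo, fun x hx => (hU x hx).1.1.2.2.2,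
    hηp, fun i => ?_⟩
  have hYB : ∀ x ∈ U, ∀ a b, vfApp (Y i) (fun y => B y a b) x = -∑ e, B x a e * C i x e b :=
    fun x hx => (hU x hx).1.1.2.1 i
  have hYη : ∀ x ∈ U, vfApp (Y i) η x = -τ i x * η x := fun x hx => (hU x hx).1.2.2.1 i
  have hCz : ∀ y ∈ U, ∀ a b, pushC id B (Y i) (C i) y a b = 0 := fun y hy a b => by
    have h : (Matrix.of fun a b => vfApp (Y i) (fun z => B z a b) y) =
        -(Matrix.of (B y) * Matrix.of (C i y)) := by
      ext a b
      simp [hYB y hy, Matrix.mul_apply]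
    simp only [pushC, id_eq]
    rw [h, ← add_mul, add_neg_cancel, zero_mul, Matrix.zero_apply]
  have hτz : ∀ y ∈ U, pushTau id (Y i) η (τ i) y = 0 := fun y hy => by
    simp only [pushTau, id_eq]
    rw [hYη y hy, mul_div_cancel_right₀ _ (hηp y hy).ne', add_neg_cancel]
  refine ⟨hCz, hτz, ?_⟩
  rw [transMu_id, transSigma_id, pushVF_id]
  exact IsSymmetry.strong_of_gauge
    ⟨fun x hx => (hsym i).1 x (hUM hx), fun x hx => (hsym i).2 x (hUM hx)⟩
    (fun x hx => hdiff hMopen hμsmooth x (hUM hx)) (fun x hx => hdiff hMopen hσsmooth x (hUM hx))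
    (hdiff hUopen hBs) (hdiff hUopen hηs) (fun x hx => hCso i x (hUM hx)) hBo hηp hYB hYη hCz hτz
end
end

section
/- Let (μ,σ) be a smooth SDE on an open set M ⊆ ℝ^n and let V = (Y,C,τ) be an infinitesimal symmetry of (μ,σ). Then for every smooth function f: M → ℝ, the identity L(Y(f)) − Y(L(f)) = τ·L(f) holds on M. -/
noncomputable section

open scoped BigOperators

section PartialDerivatives

variable {d : ℕ} {M : Set (Fin d → ℝ)} {f g : (Fin d → ℝ) → ℝ} {x : Fin d → ℝ}

lemma differentiableAt_of_smoothOn (hM : IsOpen M) (hf : ContDiffOn ℝ (⊤ : ℕ∞) f M) (hx : x ∈ M) :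
    DifferentiableAt ℝ f x :=
  (hf.contDiffAt (hM.mem_nhds hx)).differentiableAt (by simp)

lemma pd_congr (hM : IsOpen M) (h : ∀ y ∈ M, f y = g y) (hx : x ∈ M) (j : Fin d) :
    pd f j x = pd g j x := by
  have : f =ᶠ[nhds x] g := Filter.eventuallyEq_of_mem (hM.mem_nhds hx) h
  rw [pd, pd, this.fderiv_eq]

lemma pd_add (hf : DifferentiableAt ℝ f x) (hg : DifferentiableAt ℝ g x) (j : Fin d) :
    pd (fun y => f y + g y) j x = pd f j x + pd g j x := by
  simp [pd, fderiv_fun_add hf hg]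

lemma pd_mul (hf : DifferentiableAt ℝ f x) (hg : DifferentiableAt ℝ g x) (j : Fin d) :
    pd (fun y => f y * g y) j x = pd f j x * g x + f x * pd g j x := by
  simp only [pd, fderiv_fun_mul hf hg, add_apply, smul_apply, smul_eq_mul]
  ring

lemma pd_const_mul (c : ℝ) (hf : DifferentiableAt ℝ f x) (j : Fin d) :
    pd (fun y => c * f y) j x = c * pd f j x := by
  simp [pd, fderiv_const_mul hf]

lemma pd_sum {ι : Type*} {s : Finset ι} {F : ι → (Fin d → ℝ) → ℝ}
    (hF : ∀ i ∈ s, DifferentiableAt ℝ (F i) x) (j : Fin d) :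
    pd (fun y => ∑ i ∈ s, F i y) j x = ∑ i ∈ s, pd (F i) j x := by
  simp [pd, fderiv_fun_sum hF]

lemma ContDiffOn.pd (hM : IsOpen M) (hf : ContDiffOn ℝ (⊤ : ℕ∞) f M) (j : Fin d) :
    ContDiffOn ℝ (⊤ : ℕ∞) (fun y => pd f j y) M :=
  (hf.fderiv_of_isOpen hM (by simp)).clm_apply contDiffOn_const

lemma pd_comm (hM : IsOpen M) (hf : ContDiffOn ℝ (⊤ : ℕ∞) f M) (hx : x ∈ M) (i j : Fin d) :
    pd (fun y => pd f j y) i x = pd (fun y => pd f i y) j x := by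
  have hd : DifferentiableAt ℝ (fderiv ℝ f) x :=
    ((hf.fderiv_of_isOpen hM (m := 1) (by norm_cast)).contDiffAt (hM.mem_nhds hx)).differentiableAt
      (by simp)
  have hs : IsSymmSndFDerivAt ℝ f x :=
    (hf.contDiffAt (hM.mem_nhds hx)).isSymmSndFDerivAt (by simp; norm_cast)
  have key (u v : Fin d → ℝ) :
      fderiv ℝ (fun y => fderiv ℝ f y v) x u = fderiv ℝ (fderiv ℝ f) x u v := by
    simp [fderiv_clm_apply hd (differentiableAt_const v)]
  simp only [_root_.pd, key]
  exact hs _ _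

lemma pd_pd_mul (hM : IsOpen M) (hf : ContDiffOn ℝ (⊤ : ℕ∞) f M)
    (hg : ContDiffOn ℝ (⊤ : ℕ∞) g M) (hx : x ∈ M) (i j : Fin d) :
    pd (fun y => pd (fun z => f z * g z) j y) i x
      = pd (fun y => pd f j y) i x * g x + pd f j x * pd g i x
        + pd f i x * pd g j x + f x * pd (fun y => pd g j y) i x := by
  have hd {h : (Fin d → ℝ) → ℝ} (hh : ContDiffOn ℝ (⊤ : ℕ∞) h M) {y} (hy : y ∈ M) :=
    differentiableAt_of_smoothOn hM hh hy
  rw [pd_congr hM (fun y hy => pd_mul (hd hf hy) (hd hg hy) j) hx,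
    pd_add (hd ((hf.pd hM j).mul hg) hx) (hd (hf.mul (hg.pd hM j)) hx),
    pd_mul (hd (hf.pd hM j) hx) (hd hg hx), pd_mul (hd hf hx) (hd (hg.pd hM j) hx)]
  ring

end PartialDerivatives

section TensorIdentities

variable {ι κ : Type*} [Fintype ι] [Fintype κ]

lemma sum_sum_sum_mul_sum (a : κ → ι → ι → ℝ) (u : ι → ι → ι → ℝ) (w : ι → ℝ) :
    ∑ α, ∑ i, ∑ j, a α i j * ∑ k, u k i j * w k
      = ∑ k, (∑ α, ∑ i, ∑ j, a α i j * u k i j) * w k := by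
  simp only [Finset.mul_sum, Finset.sum_mul]
  conv_rhs => rw [Finset.sum_comm]
  refine Finset.sum_congr rfl fun α _ => ?_
  conv_rhs => rw [Finset.sum_comm]
  refine Finset.sum_congr rfl fun i _ => ?_
  conv_rhs => rw [Finset.sum_comm]
  refine Finset.sum_congr rfl fun j _ => Finset.sum_congr rfl fun k _ => ?_
  ring

lemma sum_mul_sum_mul (a : ι → ℝ) (u : ι → ι → ℝ) (w : ι → ℝ) :
    ∑ i, a i * ∑ k, u k i * w k = ∑ k, (∑ i, a i * u k i) * w k := by
  simp only [Finset.mul_sum, Finset.sum_mul]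
  rw [Finset.sum_comm]
  exact Finset.sum_congr rfl fun k _ => Finset.sum_congr rfl fun i _ => by ring

lemma sum_mul_antisymm_eq_zero (G C : κ → κ → ℝ) (hG : ∀ a b, G a b = G b a)
    (hC : ∀ a b, C a b = -C b a) : ∑ a, ∑ b, G a b * C a b = 0 := by
  have h : ∑ a, ∑ b, G a b * C a b = -∑ a, ∑ b, G a b * C a b := by
    conv_lhs => rw [Finset.sum_comm]
    simp only [← Finset.sum_neg_distrib]
    refine Finset.sum_congr rfl fun a _ => Finset.sum_congr rfl fun b _ => ?_
    rw [hG b a, hC b a]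
    ring
  linarith

/-- The Lie derivative of the symbol `σ σᵀ` along a vector field `y` with Jacobian `y'`,
contracted with a symmetric matrix `h`, in terms of `B = [y, σ]`. -/
lemma symbol_lie_derivative (s : ι → ℝ) (s' : ι → ι → ℝ) (y : ι → ℝ) (y' : ι → ι → ℝ)
    (h : ι → ι → ℝ) (hh : ∀ i j, h i j = h j i) :
    ∑ i, ∑ j, s i * s j * ∑ k, (y' k j * h i k + y' k i * h j k)
      - ∑ k, y k * ∑ i, ∑ j, (s' i k * s j + s i * s' j k) * h i j
      = -2 * ∑ i, ∑ j, (∑ k, (y k * s' i k - s k * y' i k)) * s j * h i j := by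
  have e1 : ∑ i, ∑ j, s i * s j * ∑ k, (y' k j * h i k + y' k i * h j k)
      = 2 * ∑ i, ∑ j, ∑ k, s k * y' i k * s j * h i j := by
    have a1 : ∑ i, ∑ j, ∑ k, s i * s j * (y' k j * h i k)
        = ∑ i, ∑ j, ∑ k, s k * y' i k * s j * h i j := by
      calc _ = ∑ i, ∑ k, ∑ j, s i * s j * (y' k j * h i k) :=
            Finset.sum_congr rfl fun i _ => Finset.sum_comm
        _ = ∑ k, ∑ i, ∑ j, s i * s j * (y' k j * h i k) := Finset.sum_comm
        _ = _ := by
            refine Finset.sum_congr rfl fun i _ => Finset.sum_congr rfl fun j _ =>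
              Finset.sum_congr rfl fun k _ => ?_
            rw [hh j i]; ring
    have a2 : ∑ i, ∑ j, ∑ k, s i * s j * (y' k i * h j k)
        = ∑ i, ∑ j, ∑ k, s i * s j * (y' k j * h i k) := by
      rw [Finset.sum_comm]
      refine Finset.sum_congr rfl fun i _ => Finset.sum_congr rfl fun j _ =>
        Finset.sum_congr rfl fun k _ => ?_
      ring
    simp only [Finset.mul_sum, mul_add, Finset.sum_add_distrib] at a1 a2 ⊢
    simp only [← Finset.mul_sum] at a1 a2 ⊢
    linarith
  have e2 : ∑ k, y k * ∑ i, ∑ j, (s' i k * s j + s i * s' j k) * h i j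
      = 2 * ∑ i, ∑ j, ∑ k, y k * s' i k * s j * h i j := by
    have a1 (k : ι) : ∑ i, ∑ j, (s' i k * s j + s i * s' j k) * h i j
        = 2 * ∑ i, ∑ j, s' i k * s j * h i j := by
      simp only [add_mul, Finset.sum_add_distrib]
      rw [two_mul]
      congr 1
      rw [Finset.sum_comm]
      refine Finset.sum_congr rfl fun i _ => Finset.sum_congr rfl fun j _ => ?_
      rw [hh j i]; ring
    have a2 : ∑ i, ∑ j, ∑ k, y k * s' i k * s j * h i j
        = ∑ k, ∑ i, ∑ j, y k * s' i k * s j * h i j := by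
      rw [Finset.sum_comm]
      conv_rhs => rw [Finset.sum_comm]
      rw [Finset.sum_comm]
      exact Finset.sum_congr rfl fun i _ => Finset.sum_comm
    rw [a2, Finset.mul_sum]
    refine Finset.sum_congr rfl fun k _ => ?_
    rw [a1]
    simp only [Finset.mul_sum]
    exact Finset.sum_congr rfl fun i _ => Finset.sum_congr rfl fun j _ => by ring
  rw [e1, e2]
  simp only [sub_mul, Finset.sum_mul, Finset.sum_sub_distrib]
  ring

/-- Under the determining equation for `σ`, the symbol of the generator is rescaled by `τ`. -/
lemma symbol_lie_derivative_of_symmetry (s : ι → κ → ℝ) (s' : ι → κ → ι → ℝ) (y : ι → ℝ)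
    (y' : ι → ι → ℝ) (C : κ → κ → ℝ) (t : ℝ) (h : ι → ι → ℝ) (hh : ∀ i j, h i j = h j i)
    (hC : ∀ a b, C a b = -C b a)
    (hB : ∀ i α, ∑ k, (y k * s' i α k - s k α * y' i k)
      = -(1/2) * t * s i α - ∑ β, s i β * C β α) :
    ∑ α, (∑ i, ∑ j, s i α * s j α * ∑ k, (y' k j * h i k + y' k i * h j k)
      - ∑ k, y k * ∑ i, ∑ j, (s' i α k * s j α + s i α * s' j α k) * h i j)
      = t * ∑ α, ∑ i, ∑ j, s i α * s j α * h i j := by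
  set G : κ → κ → ℝ := fun α β => ∑ i, ∑ j, s i β * s j α * h i j with hG
  have hGs (a b) : G a b = G b a := by
    simp only [hG]
    rw [Finset.sum_comm]
    refine Finset.sum_congr rfl fun i _ => Finset.sum_congr rfl fun j _ => ?_
    rw [hh j i]; ring
  have hz := sum_mul_antisymm_eq_zero G C hGs hC
  have hα (α : κ) : ∑ i, ∑ j, s i α * s j α * ∑ k, (y' k j * h i k + y' k i * h j k)
      - ∑ k, y k * ∑ i, ∑ j, (s' i α k * s j α + s i α * s' j α k) * h i j
      = t * G α α - 2 * ∑ β, G α β * C α β := by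
    rw [symbol_lie_derivative (fun i => s i α) (fun i k => s' i α k) y y' h hh]
    simp only [hB]
    have e : ∑ i, ∑ j, (∑ β, s i β * C β α) * s j α * h i j = -∑ β, G α β * C α β := by
      simp only [hG, Finset.sum_mul, ← Finset.sum_neg_distrib]
      conv_rhs => rw [Finset.sum_comm]
      refine Finset.sum_congr rfl fun i _ => ?_
      conv_rhs => rw [Finset.sum_comm]
      refine Finset.sum_congr rfl fun j _ => Finset.sum_congr rfl fun β _ => ?_
      rw [hC β α]; ring
    have e' : ∑ i, ∑ j, -(1/2) * t * s i α * s j α * h i j = -(1/2) * t * G α α := by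
      simp only [hG, Finset.mul_sum]
      exact Finset.sum_congr rfl fun i _ => Finset.sum_congr rfl fun j _ => by ring
    simp only [sub_mul, Finset.sum_sub_distrib, e, e']
    ring
  simp only [hα, Finset.sum_sub_distrib, ← Finset.mul_sum, hz]
  simp [hG]

end TensorIdentities

section Operators

variable {d m : ℕ} {M : Set (Fin d → ℝ)} {f : (Fin d → ℝ) → ℝ} {x : Fin d → ℝ}
  {Y μ : (Fin d → ℝ) → Fin d → ℝ} {σ : (Fin d → ℝ) → Fin d → Fin m → ℝ}

lemma pd_vfApp (hM : IsOpen M) (hY : ∀ k, ContDiffOn ℝ (⊤ : ℕ∞) (fun y => Y y k) M)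
    (hf : ContDiffOn ℝ (⊤ : ℕ∞) f M) (hx : x ∈ M) (j : Fin d) :
    pd (vfApp Y f) j x
      = ∑ k, (pd (fun y => Y y k) j x * pd f k x + Y x k * pd (fun y => pd f k y) j x) := by
  have hd {h : (Fin d → ℝ) → ℝ} (hh : ContDiffOn ℝ (⊤ : ℕ∞) h M) :=
    differentiableAt_of_smoothOn hM hh hx
  unfold vfApp
  rw [pd_sum fun k _ => hd ((hY k).mul (hf.pd hM k))]
  exact Finset.sum_congr rfl fun k _ => pd_mul (hd (hY k)) (hd (hf.pd hM k)) j

lemma pd_pd_vfApp (hM : IsOpen M) (hY : ∀ k, ContDiffOn ℝ (⊤ : ℕ∞) (fun y => Y y k) M)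
    (hf : ContDiffOn ℝ (⊤ : ℕ∞) f M) (hx : x ∈ M) (i j : Fin d) :
    pd (fun y => pd (vfApp Y f) j y) i x
      = ∑ k, (pd (fun y => pd (fun z => Y z k) j y) i x * pd f k x
          + pd (fun y => Y y k) j x * pd (fun y => pd f k y) i x
          + pd (fun y => Y y k) i x * pd (fun y => pd f k y) j x
          + Y x k * pd (fun y => pd (fun z => pd f k z) j y) i x) := by
  have hs (k : Fin d) := (hY k).mul (hf.pd hM k)
  unfold vfApp
  rw [pd_congr hM (fun y hy => pd_sum (fun k _ => differentiableAt_of_smoothOn hM (hs k) hy) j) hx,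
    pd_sum fun k _ => differentiableAt_of_smoothOn hM ((hs k).pd hM j) hx]
  exact Finset.sum_congr rfl fun k _ => pd_pd_mul hM (hY k) (hf.pd hM k) hx i j

lemma pd_gen (hM : IsOpen M) (hμ : ∀ k, ContDiffOn ℝ (⊤ : ℕ∞) (fun y => μ y k) M)
    (hσ : ∀ k α, ContDiffOn ℝ (⊤ : ℕ∞) (fun y => σ y k α) M)
    (hf : ContDiffOn ℝ (⊤ : ℕ∞) f M) (hx : x ∈ M) (k : Fin d) :
    pd (gen μ σ f) k x
      = (1/2) * ∑ α, ∑ i, ∑ j,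
          ((pd (fun y => σ y i α) k x * σ x j α + σ x i α * pd (fun y => σ y j α) k x)
              * pd (fun y => pd f j y) i x
            + σ x i α * σ x j α * pd (fun y => pd (fun z => pd f j z) i y) k x)
        + ∑ i, (pd (fun y => μ y i) k x * pd f i x + μ x i * pd (fun y => pd f i y) k x) := by
  have hd {h : (Fin d → ℝ) → ℝ} (hh : ContDiffOn ℝ (⊤ : ℕ∞) h M) :=
    differentiableAt_of_smoothOn hM hh hx
  have hσσ (α i j) := (hσ i α).mul (hσ j α)
  have h3 (α i j) := (hσσ α i j).mul ((hf.pd hM j).pd hM i)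
  have h2 (α i) := ContDiffOn.sum (s := Finset.univ) fun j _ => h3 α i j
  have h1 (α) := ContDiffOn.sum (s := Finset.univ) fun i _ => h2 α i
  have h0 := ContDiffOn.sum (s := Finset.univ) fun α _ => h1 α
  have hb (i) := (hμ i).mul (hf.pd hM i)
  have hdrift : pd (fun y => ∑ i, μ y i * pd f i y) k x
      = ∑ i, (pd (fun y => μ y i) k x * pd f i x + μ x i * pd (fun y => pd f i y) k x) := by
    rw [pd_sum fun i _ => hd (hb i)]
    exact Finset.sum_congr rfl fun i _ => pd_mul (hd (hμ i)) (hd (hf.pd hM i)) k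
  unfold gen
  rw [pd_add (hd (contDiffOn_const.mul h0)) (hd (ContDiffOn.sum fun i _ => hb i)),
    pd_const_mul _ (hd h0), hdrift, pd_sum fun α _ => hd (h1 α)]
  congr 2
  refine Finset.sum_congr rfl fun α _ => ?_
  rw [pd_sum fun i _ => hd (h2 α i)]
  refine Finset.sum_congr rfl fun i _ => ?_
  rw [pd_sum fun j _ => hd (h3 α i j)]
  refine Finset.sum_congr rfl fun j _ => ?_
  rw [pd_mul (hd (hσσ α i j)) (hd ((hf.pd hM j).pd hM i)), pd_mul (hd (hσ i α)) (hd (hσ j α))]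

/-- Leibniz rule for `L(Y(f))`: the second-order cross terms are the middle summand. -/
lemma gen_vfApp (hM : IsOpen M) (hY : ∀ k, ContDiffOn ℝ (⊤ : ℕ∞) (fun y => Y y k) M)
    (hf : ContDiffOn ℝ (⊤ : ℕ∞) f M) (hx : x ∈ M) :
    gen μ σ (vfApp Y f) x
      = ∑ k, gen μ σ (fun y => Y y k) x * pd f k x
        + (1/2) * ∑ α, ∑ i, ∑ j, σ x i α * σ x j α *
            ∑ k, (pd (fun y => Y y k) j x * pd (fun y => pd f k y) i x
              + pd (fun y => Y y k) i x * pd (fun y => pd f k y) j x)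
        + ∑ k, gen μ σ (fun y => pd f k y) x * Y x k := by
  have e1 := sum_sum_sum_mul_sum (fun α i j => σ x i α * σ x j α)
    (fun k i j => pd (fun y => pd (fun z => Y z k) j y) i x) (fun k => pd f k x)
  have e2 := sum_sum_sum_mul_sum (fun α i j => σ x i α * σ x j α)
    (fun k i j => pd (fun y => pd (fun z => pd f k z) j y) i x) (Y x)
  have e3 := sum_mul_sum_mul (μ x) (fun k i => pd (fun y => Y y k) i x) (fun k => pd f k x)
  have e4 := sum_mul_sum_mul (μ x) (fun k i => pd (fun y => pd f k y) i x) (Y x)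
  simp only [gen, pd_pd_vfApp hM hY hf hx, pd_vfApp hM hY hf hx, add_mul, Finset.sum_add_distrib,
    mul_add, mul_assoc, ← Finset.mul_sum, mul_comm (Y x _)] at e1 e2 e3 e4 ⊢
  linear_combination (1/2) * e1 + (1/2) * e2 + e3 + e4

/-- Leibniz rule for `Y(L(f))`: the derivatives of the symbol are the middle summand. -/
lemma vfApp_gen (hM : IsOpen M) (hμ : ∀ k, ContDiffOn ℝ (⊤ : ℕ∞) (fun y => μ y k) M)
    (hσ : ∀ k α, ContDiffOn ℝ (⊤ : ℕ∞) (fun y => σ y k α) M)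
    (hf : ContDiffOn ℝ (⊤ : ℕ∞) f M) (hx : x ∈ M) :
    vfApp Y (gen μ σ f) x
      = ∑ k, vfApp Y (fun y => μ y k) x * pd f k x
        + (1/2) * ∑ α, ∑ k, Y x k * ∑ i, ∑ j,
            (pd (fun y => σ y i α) k x * σ x j α + σ x i α * pd (fun y => σ y j α) k x)
              * pd (fun y => pd f j y) i x
        + ∑ k, gen μ σ (fun y => pd f k y) x * Y x k := by
  have hthird (i j k : Fin d) : pd (fun y => pd (fun z => pd f k z) j y) i x
      = pd (fun y => pd (fun z => pd f j z) i y) k x := by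
    rw [pd_congr hM (fun y hy => pd_comm hM hf hy j k) hx]
    exact pd_comm hM (hf.pd hM j) hx i k
  have hgen (k : Fin d) : pd (gen μ σ f) k x
      = (1/2) * ∑ α, ∑ i, ∑ j,
            (pd (fun y => σ y i α) k x * σ x j α + σ x i α * pd (fun y => σ y j α) k x)
              * pd (fun y => pd f j y) i x
        + ∑ i, pd (fun y => μ y i) k x * pd f i x + gen μ σ (fun y => pd f k y) x := by
    simp only [pd_gen hM hμ hσ hf hx, gen, hthird _ _ k, pd_comm hM hf hx _ k,
      Finset.sum_add_distrib]
    ring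
  have e := sum_mul_sum_mul (Y x) (fun i k => pd (fun y => μ y i) k x) (fun i => pd f i x)
  rw [Finset.sum_comm (s := (Finset.univ : Finset (Fin m)))]
  simp only [vfApp] at e ⊢
  rw [← e, Finset.mul_sum, ← Finset.sum_add_distrib, ← Finset.sum_add_distrib]
  refine Finset.sum_congr rfl fun k _ => ?_
  rw [hgen, ← Finset.mul_sum]
  ring

end Operators

/-- Lemma 4.2, second identity.  If `V = (Y,C,τ)` is an infinitesimal
symmetry of `(μ,σ)`, then for every smooth `f`, `L(Y(f)) − Y(L(f)) = τ·L(f)` on `M`. -/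
theorem symmetry_generator_commutation_identity
    {n m : ℕ}
    (M : Set (Fin n → ℝ)) (hMopen : IsOpen M)
    (μ : (Fin n → ℝ) → Fin n → ℝ) (σ : (Fin n → ℝ) → Fin n → Fin m → ℝ)
    (hμsmooth : ContDiffOn ℝ (⊤ : ℕ∞) μ M) (hσsmooth : ContDiffOn ℝ (⊤ : ℕ∞) σ M)
    (Y : (Fin n → ℝ) → Fin n → ℝ) (C : (Fin n → ℝ) → Fin m → Fin m → ℝ)
    (τ : (Fin n → ℝ) → ℝ)
    (hYsmooth : ContDiffOn ℝ (⊤ : ℕ∞) Y M) (hCsmooth : ContDiffOn ℝ (⊤ : ℕ∞) C M)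
    (hτsmooth : ContDiffOn ℝ (⊤ : ℕ∞) τ M)
    (hCso : ∀ x ∈ M, ∀ a b, C x a b = - C x b a)
    (hsym : IsSymmetry M μ σ Y C τ)
    (f : (Fin n → ℝ) → ℝ) (hfsmooth : ContDiffOn ℝ (⊤ : ℕ∞) f M) :
    ∀ x ∈ M,
      gen μ σ (vfApp Y f) x - vfApp Y (gen μ σ f) x = τ x * gen μ σ f x := by
  intro x hx
  have hY (k) : ContDiffOn ℝ (⊤ : ℕ∞) (fun y => Y y k) M := contDiffOn_pi.1 hYsmooth k
  have hμ (k) : ContDiffOn ℝ (⊤ : ℕ∞) (fun y => μ y k) M := contDiffOn_pi.1 hμsmooth k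
  have hσ (k α) : ContDiffOn ℝ (⊤ : ℕ∞) (fun y => σ y k α) M :=
    contDiffOn_pi.1 (contDiffOn_pi.1 hσsmooth k) α
  have hsecond := symbol_lie_derivative_of_symmetry (σ x) (fun i α k => pd (fun y => σ y i α) k x)
    (Y x) (fun k i => pd (fun y => Y y k) i x) (C x) (τ x) (fun i j => pd (fun y => pd f j y) i x)
    (pd_comm hMopen hfsmooth hx) (hCso x hx) (hsym.1 x hx)
  have hfirst : ∑ k, (gen μ σ (fun y => Y y k) x - vfApp Y (fun y => μ y k) x) * pd f k x
      = τ x * ∑ k, μ x k * pd f k x := by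
    rw [Finset.mul_sum]
    refine Finset.sum_congr rfl fun k _ => ?_
    linear_combination -pd f k x * hsym.2 x hx k
  simp only [sub_mul, Finset.sum_sub_distrib] at hfirst hsecond
  rw [gen_vfApp hMopen hY hfsmooth hx, vfApp_gen hMopen hμ hσ hfsmooth hx, gen]
  linear_combination hfirst + (1/2) * hsecond
end
end

section
/- Let M ⊆ ℝ^n be a connected open set, (μ,σ) a smooth SDE on M, Ψ: M → M' ⊆ ℝ^{n−r} a reduction map, and Y_1,…,Y_k reduction vector fields for Ψ such that each (Y_i,C_i,0) is an infinitesimal symmetry of (μ,σ) (a quasi-strong symmetry). If ∇Ψ·σ·C_i = 0 on M for every i = 1,…,k, then there exists a unique pair of smooth maps μ': M' → ℝ^{n−r} and σ': M' → Mat(n−r,m;ℝ) such that L(Ψ) = μ' ∘ Ψ and ∇Ψ·σ = σ' ∘ Ψ on M. -/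
noncomputable section

open scoped BigOperators

open scoped Topology

/-- Near a point where a smooth map is submersive, it admits a smooth local section through that
point, and every map whose differential annihilates the kernels of the differential of the
submersion is locally determined by its values along the section. -/
theorem exists_local_section_of_ker_fderiv_le
    {E F G : Type*} [NormedAddCommGroup E] [NormedSpace ℝ E] [FiniteDimensional ℝ E]
    [NormedAddCommGroup F] [NormedSpace ℝ F] [FiniteDimensional ℝ F]
    [NormedAddCommGroup G] [NormedSpace ℝ G]
    {M : Set E} (hM : IsOpen M) {Ψ : E → F} {f : E → G}
    (hΨ : ContDiffOn ℝ (⊤ : ℕ∞) Ψ M) (hf : ContDiffOn ℝ (⊤ : ℕ∞) f M)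
    (hker : ∀ x ∈ M, ∀ v, fderiv ℝ Ψ x v = 0 → fderiv ℝ f x v = 0)
    {a : E} (ha : a ∈ M) (hsurj : Function.Surjective (fderiv ℝ Ψ a)) :
    ∃ s : F → E, ContDiffAt ℝ (⊤ : ℕ∞) s (Ψ a) ∧ s (Ψ a) = a ∧
      (∀ᶠ y in 𝓝 (Ψ a), Ψ (s y) = y) ∧ ∀ᶠ x in 𝓝 a, f x = f (s (Ψ x)) := by
  have : CompleteSpace E := FiniteDimensional.complete ℝ E
  have : CompleteSpace F := FiniteDimensional.complete ℝ F
  have hΨa : ContDiffAt ℝ (⊤ : ℕ∞) Ψ a := hΨ.contDiffAt (hM.mem_nhds ha)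
  have hstrict : HasStrictFDerivAt Ψ (fderiv ℝ Ψ a) a := hΨa.hasStrictFDerivAt (by simp)
  let φ := HasStrictFDerivAt.implicitFunctionDataOfComplemented Ψ (fderiv ℝ Ψ a) hstrict
    (LinearMap.range_eq_top.2 hsurj)
    (ContinuousLinearMap.ker_closedComplemented_of_finiteDimensional_range _)
  let Φ := φ.toOpenPartialHomeomorph
  have haΦ : a ∈ Φ.source := φ.pt_mem_toOpenPartialHomeomorph_source
  have hΦ1 : ∀ x, (Φ x).1 = Ψ x := fun x => rfl
  have hΦsmooth : ContDiffAt ℝ (⊤ : ℕ∞) Φ a :=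
    hΨa.prodMk ((ContinuousLinearMap.contDiff _).contDiffAt.comp a
      (contDiffAt_id.sub contDiffAt_const))
  have hsymm : ContDiffAt ℝ (⊤ : ℕ∞) Φ.symm (Φ a) := by
    apply Φ.contDiffAt_symm (Φ.map_source haΦ)
    · rw [Φ.left_inv haΦ]
      exact φ.hasStrictFDerivAt.hasFDerivAt
    · rwa [Φ.left_inv haΦ]
  have hS : ∀ᶠ z in 𝓝 (Φ a), z ∈ Φ.target ∧ Φ.symm z ∈ M ∧ ContDiffAt ℝ 1 Φ.symm z := by
    refine Filter.Eventually.and (Φ.open_target.mem_nhds (Φ.map_source haΦ)) (.and ?_ ?_)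
    · apply hsymm.continuousAt.eventually_mem
      rw [Φ.left_inv haΦ]
      exact hM.mem_nhds ha
    · exact (hsymm.of_le (by exact_mod_cast le_top)).eventually (by simp)
  obtain ⟨ε, hε, hB⟩ := Metric.eventually_nhds_iff_ball.1 hS
  have hright : ∀ z ∈ Metric.ball (Φ a) ε, Ψ (Φ.symm z) = z.1 := fun z hz => by
    rw [← hΦ1, Φ.right_inv (hB z hz).1]
  have hconst : ∀ z ∈ Metric.ball (Φ a) ε, f (Φ.symm z) = f (Φ.symm (z.1, (Φ a).2)) := by
    rintro ⟨y, w⟩ hz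
    have hslice : ∀ w', w' ∈ Metric.ball (Φ a).2 ε → (y, w') ∈ Metric.ball (Φ a) ε := by
      intro w' hw'
      rw [← ball_prod_same] at hz ⊢
      exact ⟨hz.1, hw'⟩
    have hd : ∀ w' ∈ Metric.ball (Φ a).2 ε,
        HasFDerivAt (fun w' => f (Φ.symm (y, w'))) (0 : _ →L[ℝ] G) w' := by
      intro w' hw'
      obtain ⟨-, hm, hc⟩ := hB _ (hslice w' hw')
      have hdΦ := (hc.differentiableAt (by simp)).hasFDerivAt.comp w'
        (hasFDerivAt_prodMk_right y w')
      have hdf := ((hf.contDiffAt (hM.mem_nhds hm)).differentiableAt (by simp)).hasFDerivAt.comp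
        w' hdΦ
      have hdΨ := ((hΨ.contDiffAt (hM.mem_nhds hm)).differentiableAt (by simp)).hasFDerivAt.comp
        w' hdΦ
      have hdy : HasFDerivAt (fun w' => Ψ (Φ.symm (y, w'))) (0 : _ →L[ℝ] F) w' := by
        refine (hasFDerivAt_const y w').congr_of_eventuallyEq ?_
        filter_upwards [Metric.isOpen_ball.mem_nhds hw'] with u hu
        exact hright _ (hslice u hu)
      refine hdf.congr_fderiv ?_
      ext v
      refine hker _ hm _ ?_
      exact DFunLike.congr_fun (hdΨ.unique hdy) v
    have hw : w ∈ Metric.ball (Φ a).2 ε := by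
      rw [← ball_prod_same] at hz
      exact hz.2
    exact (convex_ball (Φ a).2 ε).is_const_of_fderivWithin_eq_zero (𝕜 := ℝ)
      (f := fun w' => f (Φ.symm (y, w')))
      (fun u hu => (hd u hu).differentiableAt.differentiableWithinAt)
      (fun u hu => by
        rw [fderivWithin_of_isOpen Metric.isOpen_ball hu, (hd u hu).fderiv])
      hw (Metric.mem_ball_self hε)
  refine ⟨fun y => Φ.symm (y, (Φ a).2), ?_, ?_, ?_, ?_⟩
  · exact ContDiffAt.comp (Ψ a) hsymm (contDiffAt_id.prodMk contDiffAt_const)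
  · exact Φ.left_inv haΦ
  · filter_upwards [Metric.ball_mem_nhds (Ψ a) hε] with y hy
    apply hright (y, (Φ a).2)
    rw [← ball_prod_same]
    exact ⟨hy, Metric.mem_ball_self hε⟩
  · filter_upwards [Φ.open_source.mem_nhds haΦ,
      (Φ.continuousAt haΦ).eventually_mem (Metric.ball_mem_nhds _ hε)] with x hx hxB
    have := hconst _ hxB
    rwa [Φ.left_inv hx] at this

/-- A smooth map whose differential annihilates the kernels of the differential of a submersion
with preconnected fibres descends to a smooth map on the image of the submersion. -/
theorem exists_contDiffOn_factor_of_ker_fderiv_le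
    {E F G : Type*} [NormedAddCommGroup E] [NormedSpace ℝ E] [FiniteDimensional ℝ E]
    [NormedAddCommGroup F] [NormedSpace ℝ F] [FiniteDimensional ℝ F]
    [NormedAddCommGroup G] [NormedSpace ℝ G]
    {M : Set E} (hM : IsOpen M) {Ψ : E → F} {f : E → G}
    (hΨ : ContDiffOn ℝ (⊤ : ℕ∞) Ψ M) (hf : ContDiffOn ℝ (⊤ : ℕ∞) f M)
    (hsurj : ∀ x ∈ M, Function.Surjective (fderiv ℝ Ψ x))
    (hfib : ∀ y, IsPreconnected {x ∈ M | Ψ x = y})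
    (hker : ∀ x ∈ M, ∀ v, fderiv ℝ Ψ x v = 0 → fderiv ℝ f x v = 0) :
    ∃ g : F → G, ContDiffOn ℝ (⊤ : ℕ∞) g (Ψ '' M) ∧ ∀ x ∈ M, f x = g (Ψ x) := by
  have hconst : ∀ x ∈ M, ∀ x' ∈ M, Ψ x = Ψ x' → f x = f x' := by
    intro x hx x' hx' h
    have := isPreconnected_iff_preconnectedSpace.1 (hfib (Ψ x'))
    have hloc : IsLocallyConstant (fun z : {x ∈ M | Ψ x = Ψ x'} => f z) := by
      rw [IsLocallyConstant.iff_eventually_eq]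
      rintro ⟨z, hzM, hz⟩
      obtain ⟨s, -, hs, -, hfs⟩ :=
        exists_local_section_of_ker_fderiv_le hM hΨ hf hker hzM (hsurj z hzM)
      filter_upwards [continuousAt_subtype_val.eventually hfs] with u hu
      rw [hu, show Ψ u = Ψ z from u.2.2.trans hz.symm, hs]
    exact hloc.apply_eq_of_preconnectedSpace ⟨x, hx, h⟩ ⟨x', hx', rfl⟩
  refine ⟨fun y => f (Function.invFunOn Ψ M y), ?_, ?_⟩
  · rintro _ ⟨a, ha, rfl⟩
    obtain ⟨s, hs, hsa, hΨs, -⟩ :=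
      exists_local_section_of_ker_fderiv_le hM hΨ hf hker ha (hsurj a ha)
    have hfs : ContDiffAt ℝ (⊤ : ℕ∞) (fun y => f (s y)) (Ψ a) := by
      refine ContDiffAt.comp (Ψ a) ?_ hs
      rw [hsa]
      exact hf.contDiffAt (hM.mem_nhds ha)
    refine (hfs.congr_of_eventuallyEq ?_).contDiffWithinAt
    have hsM : ∀ᶠ y in 𝓝 (Ψ a), s y ∈ M :=
      hs.continuousAt.eventually_mem (by rw [hsa]; exact hM.mem_nhds ha)
    filter_upwards [hΨs, hsM] with y hy hyM
    have hex : ∃ x ∈ M, Ψ x = y := ⟨s y, hyM, hy⟩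
    exact hconst _ (Function.invFunOn_mem hex) _ hyM ((Function.invFunOn_eq hex).trans hy.symm)
  · intro x hx
    have hex : ∃ x' ∈ M, Ψ x' = Ψ x := ⟨x, hx, rfl⟩
    exact hconst _ hx _ (Function.invFunOn_mem hex) (Function.invFunOn_eq hex).symm

section Derivations

variable {E : Type*} [NormedAddCommGroup E] [NormedSpace ℝ E] {M : Set E} {f : E → ℝ} {Y : E → E}

/-- First derivative of the identity `Y(f) = 0`. -/
theorem fderiv_fderiv_apply_add_eq_zero (hM : IsOpen M)
    (hf : ContDiffOn ℝ (⊤ : ℕ∞) f M) (hY : ContDiffOn ℝ (⊤ : ℕ∞) Y M)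
    (h : ∀ x ∈ M, fderiv ℝ f x (Y x) = 0) {x : E} (hx : x ∈ M) (v : E) :
    fderiv ℝ (fderiv ℝ f) x (Y x) v + fderiv ℝ f x (fderiv ℝ Y x v) = 0 := by
  have hfx := hf.contDiffAt (hM.mem_nhds hx)
  have hf1 : ContDiffAt ℝ (⊤ : ℕ∞) (fderiv ℝ f) x := hfx.fderiv_right (by simp)
  have hYx := hY.contDiffAt (hM.mem_nhds hx)
  have hd := (hf1.differentiableAt (by simp)).hasFDerivAt.clm_apply
    (hYx.differentiableAt (by simp)).hasFDerivAt
  have h0 : HasFDerivAt (fun z => fderiv ℝ f z (Y z)) (0 : E →L[ℝ] ℝ) x := by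
    refine (hasFDerivAt_const (0 : ℝ) x).congr_of_eventuallyEq ?_
    filter_upwards [hM.mem_nhds hx] with z hz using h z hz
  have hv := DFunLike.congr_fun (hd.unique h0) v
  have hsymm : IsSymmSndFDerivAt ℝ f x := hfx.isSymmSndFDerivAt
    (by simpa using WithTop.coe_le_coe.2 (le_top : (2 : ℕ∞) ≤ ⊤))
  rw [hsymm.eq (Y x) v]
  simp at hv
  linarith

/-- Second derivative of the identity `Y(f) = 0`. -/
theorem fderiv_fderiv_fderiv_apply_add_eq_zero (hM : IsOpen M)
    (hf : ContDiffOn ℝ (⊤ : ℕ∞) f M) (hY : ContDiffOn ℝ (⊤ : ℕ∞) Y M)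
    (h : ∀ x ∈ M, fderiv ℝ f x (Y x) = 0) {x : E} (hx : x ∈ M) (v : E) :
    fderiv ℝ (fderiv ℝ (fderiv ℝ f)) x (Y x) v v + 2 * fderiv ℝ (fderiv ℝ f) x (fderiv ℝ Y x v) v
      + fderiv ℝ f x (fderiv ℝ (fderiv ℝ Y) x v v) = 0 := by
  have hfx := hf.contDiffAt (hM.mem_nhds hx)
  have hf1 : ContDiffAt ℝ (⊤ : ℕ∞) (fderiv ℝ f) x := hfx.fderiv_right (by simp)
  have hf2 : ContDiffAt ℝ (⊤ : ℕ∞) (fderiv ℝ (fderiv ℝ f)) x := hf1.fderiv_right (by simp)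
  have hYx := hY.contDiffAt (hM.mem_nhds hx)
  have hY1 : ContDiffAt ℝ (⊤ : ℕ∞) (fderiv ℝ Y) x := hYx.fderiv_right (by simp)
  have hd := (((hf2.differentiableAt (by simp)).hasFDerivAt.clm_apply
    (hYx.differentiableAt (by simp)).hasFDerivAt).clm_apply (hasFDerivAt_const v x)).add
    ((hf1.differentiableAt (by simp)).hasFDerivAt.clm_apply
      ((hY1.differentiableAt (by simp)).hasFDerivAt.clm_apply (hasFDerivAt_const v x)))
  have h0 : HasFDerivAt (fun z => fderiv ℝ (fderiv ℝ f) z (Y z) v + fderiv ℝ f z (fderiv ℝ Y z v))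
      (0 : E →L[ℝ] ℝ) x := by
    refine (hasFDerivAt_const (0 : ℝ) x).congr_of_eventuallyEq ?_
    filter_upwards [hM.mem_nhds hx] with z hz
      using fderiv_fderiv_apply_add_eq_zero hM hf hY h hz v
  have hv := DFunLike.congr_fun (hd.unique h0) v
  have hsymm : IsSymmSndFDerivAt ℝ f x := hfx.isSymmSndFDerivAt
    (by simpa using WithTop.coe_le_coe.2 (le_top : (2 : ℕ∞) ≤ ⊤))
  have hsymm1 : IsSymmSndFDerivAt ℝ (fderiv ℝ f) x :=
    hf1.isSymmSndFDerivAt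
    (by simpa using WithTop.coe_le_coe.2 (le_top : (2 : ℕ∞) ≤ ⊤))
  rw [hsymm1.eq (Y x) v]
  simp at hv
  rw [hsymm.eq v (fderiv ℝ Y x v)] at hv
  linarith

/-- If `Y(f) = 0` and `[Y, S] = -w` with `w(f) = 0`, then `Y(S(f)) = 0`. -/
theorem fderiv_fderiv_apply_eq_zero_of_bracket (hM : IsOpen M)
    (hf : ContDiffOn ℝ (⊤ : ℕ∞) f M) (hY : ContDiffOn ℝ (⊤ : ℕ∞) Y M)
    (h : ∀ x ∈ M, fderiv ℝ f x (Y x) = 0) {S : E → E} (hS : ContDiffOn ℝ (⊤ : ℕ∞) S M)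
    {x : E} (hx : x ∈ M) {w : E} (hw : fderiv ℝ f x w = 0)
    (hSY : fderiv ℝ S x (Y x) = fderiv ℝ Y x (S x) - w) :
    fderiv ℝ (fun z => fderiv ℝ f z (S z)) x (Y x) = 0 := by
  have hf1 : ContDiffAt ℝ (⊤ : ℕ∞) (fderiv ℝ f) x :=
    (hf.contDiffAt (hM.mem_nhds hx)).fderiv_right (by simp)
  have hd := (hf1.differentiableAt (by simp)).hasFDerivAt.clm_apply
    ((hS.contDiffAt (hM.mem_nhds hx)).differentiableAt (by simp)).hasFDerivAt
  have h1 := fderiv_fderiv_apply_add_eq_zero hM hf hY h hx (S x)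
  rw [hd.fderiv]
  simp [hSY, hw]
  linarith

/-- The full contraction of an antisymmetric array with a symmetric one vanishes. -/
theorem sum_sum_mul_eq_zero_of_symm_of_antisymm {ι : Type*} [Fintype ι] {A B : ι → ι → ℝ}
    (hA : ∀ a b, A a b = -A b a) (hB : ∀ a b, B a b = B b a) :
    ∑ a, ∑ b, A b a * B b a = 0 := by
  have h : ∑ a, ∑ b, A b a * B b a = -∑ a, ∑ b, A b a * B b a := by
    conv_lhs => rw [Finset.sum_comm]
    simp only [← Finset.sum_neg_distrib]
    refine Finset.sum_congr rfl fun a _ => Finset.sum_congr rfl fun b _ => ?_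
    rw [hA a b, hB a b]
    ring
  linarith

/-- If `Y(f) = 0` and `Y` satisfies the determining equations of a quasi-strong symmetry of the
diffusion with coefficients `D`, `S`, then `Y(L(f)) = 0`. -/
theorem fderiv_generator_apply_eq_zero {ι : Type*} [Fintype ι] (hM : IsOpen M)
    (hf : ContDiffOn ℝ (⊤ : ℕ∞) f M) (hY : ContDiffOn ℝ (⊤ : ℕ∞) Y M)
    (h : ∀ x ∈ M, fderiv ℝ f x (Y x) = 0) {S : ι → E → E} {D : E → E}
    (hS : ∀ a, ContDiffOn ℝ (⊤ : ℕ∞) (S a) M) (hD : ContDiffOn ℝ (⊤ : ℕ∞) D M)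
    {x : E} (hx : x ∈ M) {A : ι → ι → ℝ} (hA : ∀ a b, A a b = -A b a)
    (hSY : ∀ a, fderiv ℝ (S a) x (Y x) = fderiv ℝ Y x (S a x) - ∑ b, A b a • S b x)
    (hDY : fderiv ℝ D x (Y x)
      = (1 / 2 : ℝ) • ∑ a, fderiv ℝ (fderiv ℝ Y) x (S a x) (S a x) + fderiv ℝ Y x (D x)) :
    fderiv ℝ (fun z => (1 / 2) * ∑ a, fderiv ℝ (fderiv ℝ f) z (S a z) (S a z)
      + fderiv ℝ f z (D z)) x (Y x) = 0 := by
  have hfx := hf.contDiffAt (hM.mem_nhds hx)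
  have hf1 : ContDiffAt ℝ (⊤ : ℕ∞) (fderiv ℝ f) x := hfx.fderiv_right (by simp)
  have hf2 : ContDiffAt ℝ (⊤ : ℕ∞) (fderiv ℝ (fderiv ℝ f)) x := hf1.fderiv_right (by simp)
  have hSd : ∀ a, HasFDerivAt (S a) (fderiv ℝ (S a) x) x := fun a =>
    (((hS a).contDiffAt (hM.mem_nhds hx)).differentiableAt (by simp)).hasFDerivAt
  have hd := ((HasFDerivAt.fun_sum (u := Finset.univ) fun a _ =>
    ((hf2.differentiableAt (by simp)).hasFDerivAt.clm_apply (hSd a)).clm_apply (hSd a)).const_mul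
      (1 / 2)).fun_add ((hf1.differentiableAt (by simp)).hasFDerivAt.clm_apply
      ((hD.contDiffAt (hM.mem_nhds hx)).differentiableAt (by simp)).hasFDerivAt)
  have hsymm : IsSymmSndFDerivAt ℝ f x := hfx.isSymmSndFDerivAt
    (by simpa using WithTop.coe_le_coe.2 (le_top : (2 : ℕ∞) ≤ ⊤))
  have hterm : ∀ a,
      fderiv ℝ (fderiv ℝ (fderiv ℝ f)) x (Y x) (S a x) (S a x)
        + 2 * fderiv ℝ (fderiv ℝ f) x (fderiv ℝ (S a) x (Y x)) (S a x)
        = -fderiv ℝ f x (fderiv ℝ (fderiv ℝ Y) x (S a x) (S a x))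
          - 2 * ∑ b, A b a * fderiv ℝ (fderiv ℝ f) x (S b x) (S a x) := by
    intro a
    have h2 := fderiv_fderiv_fderiv_apply_add_eq_zero hM hf hY h hx (S a x)
    rw [hSY]
    simp
    linarith
  have htrace : ∑ a, ∑ b, A b a * fderiv ℝ (fderiv ℝ f) x (S b x) (S a x) = 0 :=
    sum_sum_mul_eq_zero_of_symm_of_antisymm hA fun a b => hsymm.eq _ _
  have h1 := fderiv_fderiv_apply_add_eq_zero hM hf hY h hx (D x)
  have hsum : ∑ a, (fderiv ℝ (fderiv ℝ (fderiv ℝ f)) x (Y x) (S a x) (S a x)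
        + 2 * fderiv ℝ (fderiv ℝ f) x (fderiv ℝ (S a) x (Y x)) (S a x))
      = -∑ a, fderiv ℝ f x (fderiv ℝ (fderiv ℝ Y) x (S a x) (S a x)) := by
    rw [Finset.sum_congr rfl fun a _ => hterm a, Finset.sum_sub_distrib, ← Finset.mul_sum, htrace]
    simp
  have hfold : ∑ a, (fderiv ℝ (fderiv ℝ f) x (S a x) (fderiv ℝ (S a) x (Y x))
      + (fderiv ℝ (fderiv ℝ f) x (fderiv ℝ (S a) x (Y x)) (S a x)
        + fderiv ℝ (fderiv ℝ (fderiv ℝ f)) x (Y x) (S a x) (S a x)))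
      = ∑ a, (fderiv ℝ (fderiv ℝ (fderiv ℝ f)) x (Y x) (S a x) (S a x)
        + 2 * fderiv ℝ (fderiv ℝ f) x (fderiv ℝ (S a) x (Y x)) (S a x)) := by
    refine Finset.sum_congr rfl fun a _ => ?_
    rw [hsymm.eq (S a x)]
    ring
  rw [hd.fderiv]
  simp only [_root_.add_apply, _root_.smul_apply,
    _root_.sum_apply, ContinuousLinearMap.comp_apply,
    ContinuousLinearMap.flip_apply, smul_eq_mul, hDY, map_add, map_smul, map_sum]
  rw [hfold, hsum]
  linarith

end Derivations

section Coordinates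

variable {d m : ℕ}

theorem sum_pd_mul (f : (Fin d → ℝ) → ℝ) (x v : Fin d → ℝ) :
    ∑ j, pd f j x * v j = fderiv ℝ f x v := by
  conv_rhs => rw [pi_eq_sum_univ' v]
  simp [pd, mul_comm]

theorem sum_mul_pd (f : (Fin d → ℝ) → ℝ) (x v : Fin d → ℝ) :
    ∑ j, v j * pd f j x = fderiv ℝ f x v := by
  simp only [← sum_pd_mul, mul_comm]

theorem fderiv_coord {ι : Type*} [Fintype ι] {f : (Fin d → ℝ) → ι → ℝ} {x : Fin d → ℝ}
    (hf : DifferentiableAt ℝ f x) (i : ι) (v : Fin d → ℝ) :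
    fderiv ℝ (fun y => f y i) x v = fderiv ℝ f x v i := by
  rw [fderiv_apply hf]
  rfl

theorem fderiv_fderiv_coord {ι : Type*} [Fintype ι] {f : (Fin d → ℝ) → ι → ℝ} {x : Fin d → ℝ}
    (hf : ContDiffAt ℝ (⊤ : ℕ∞) f x) (i : ι) (u v : Fin d → ℝ) :
    fderiv ℝ (fderiv ℝ fun y => f y i) x u v = fderiv ℝ (fderiv ℝ f) x u v i := by
  have hev : (fderiv ℝ fun y => f y i) =ᶠ[𝓝 x]
      fun y => (ContinuousLinearMap.proj (R := ℝ) i).comp (fderiv ℝ f y) := by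
    have h1 : ContDiffAt ℝ 1 f x := hf.of_le (by exact_mod_cast le_top)
    filter_upwards [h1.eventually (by simp)] with y hy
    ext v
    exact fderiv_coord (hy.differentiableAt (by simp)) i v
  have hf1 : ContDiffAt ℝ (⊤ : ℕ∞) (fderiv ℝ f) x := hf.fderiv_right (by simp)
  have hd := (hasFDerivAt_const (ContinuousLinearMap.proj (R := ℝ) (φ := fun _ : ι => ℝ) i)
    x).clm_comp (hf1.differentiableAt (by simp)).hasFDerivAt
  rw [hev.fderiv_eq, hd.fderiv]
  simp

/-- Coordinate-free form of the generator. -/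
theorem gen_eq (μ : (Fin d → ℝ) → Fin d → ℝ) (σ : (Fin d → ℝ) → Fin d → Fin m → ℝ)
    {f : (Fin d → ℝ) → ℝ} {x : Fin d → ℝ} (hf : ContDiffAt ℝ (⊤ : ℕ∞) f x) :
    gen μ σ f x = (1 / 2) * ∑ a, fderiv ℝ (fderiv ℝ f) x (fun i => σ x i a) (fun i => σ x i a)
      + fderiv ℝ f x (μ x) := by
  have hf1 : ContDiffAt ℝ (⊤ : ℕ∞) (fderiv ℝ f) x := hf.fderiv_right (by simp)
  have hpd : ∀ i j, pd (fun y => pd f j y) i x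
      = fderiv ℝ (fderiv ℝ f) x (Pi.single i 1) (Pi.single j 1) := by
    intro i j
    have hd := (hf1.differentiableAt (by simp)).hasFDerivAt.clm_apply
      (hasFDerivAt_const (Pi.single j 1 : Fin d → ℝ) x)
    simp only [pd]
    rw [hd.fderiv]
    simp
  have hvec : ∀ v : Fin d → ℝ, v = ∑ i, v i • (Pi.single i 1 : Fin d → ℝ) := fun v => by
    ext j
    simp [Pi.single_apply]
  rw [gen, sum_mul_pd]
  congr 2
  refine Finset.sum_congr rfl fun a _ => ?_
  conv_rhs => rw [hvec fun i => σ x i a]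
  simp only [hpd, map_sum, map_smul, _root_.sum_apply,
    _root_.smul_apply, smul_eq_mul, Finset.mul_sum]
  rw [Finset.sum_comm]
  refine Finset.sum_congr rfl fun i _ => Finset.sum_congr rfl fun j _ => ?_
  ring

/-- Vector form of the determining equations of a quasi-strong symmetry. -/
theorem IsSymmetry.fderiv_eq {M : Set (Fin d → ℝ)} (hM : IsOpen M)
    {μ : (Fin d → ℝ) → Fin d → ℝ} {σ : (Fin d → ℝ) → Fin d → Fin m → ℝ}
    (hμ : ContDiffOn ℝ (⊤ : ℕ∞) μ M) (hσ : ∀ a, ContDiffOn ℝ (⊤ : ℕ∞) (fun x i => σ x i a) M)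
    {Y : (Fin d → ℝ) → Fin d → ℝ} (hY : ContDiffOn ℝ (⊤ : ℕ∞) Y M)
    {C : (Fin d → ℝ) → Fin m → Fin m → ℝ} (hsym : IsSymmetry M μ σ Y C fun _ => 0)
    {x : Fin d → ℝ} (hx : x ∈ M) :
    (∀ a, fderiv ℝ (fun y i => σ y i a) x (Y x)
      = fderiv ℝ Y x (fun i => σ x i a) - ∑ b, C x b a • fun i => σ x i b) ∧
    fderiv ℝ μ x (Y x)
      = (1 / 2 : ℝ) • ∑ a, fderiv ℝ (fderiv ℝ Y) x (fun i => σ x i a) (fun i => σ x i a)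
        + fderiv ℝ Y x (μ x) := by
  have hYx := hY.contDiffAt (hM.mem_nhds hx)
  have hYd : DifferentiableAt ℝ Y x := hYx.differentiableAt (by simp)
  constructor
  · intro a
    ext i
    have h := hsym.1 x hx i a
    have hσd : DifferentiableAt ℝ (fun y i => σ y i a) x :=
      ((hσ a).contDiffAt (hM.mem_nhds hx)).differentiableAt (by simp)
    have hb : mixBracket Y σ x i a
        = fderiv ℝ (fun y i => σ y i a) x (Y x) i - fderiv ℝ Y x (fun i => σ x i a) i := by
      rw [mixBracket, Finset.sum_sub_distrib, sum_mul_pd, sum_mul_pd _ x fun k => σ x k a,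
        fderiv_coord hYd, ← fderiv_coord hσd]
    rw [hb] at h
    simp [mul_comm] at h ⊢
    linarith
  · ext i
    have h := hsym.2 x hx i
    have hYi : ContDiffAt ℝ (⊤ : ℕ∞) (fun y => Y y i) x := contDiffAt_pi.1 hYx i
    rw [vfApp, sum_mul_pd, gen_eq μ σ hYi, fderiv_coord hYd,
      fderiv_coord ((hμ.contDiffAt (hM.mem_nhds hx)).differentiableAt (by simp))] at h
    simp only [fderiv_fderiv_coord hYx] at h
    simp at h ⊢
    linarith

end Coordinates

/-- Theorem 4.1.  If `Ψ` is a reduction map with reduction vector fields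
`Y_1,…,Y_k` such that the `(Y_i,C_i,0)` are quasi-strong symmetries of `(μ,σ)` and
`∇Ψ·σ·C_i = 0`, then there is a unique SDE `(μ',σ')` on `M'` with `L(Ψ) = μ' ∘ Ψ` and
`∇Ψ·σ = σ' ∘ Ψ`. -/
theorem reduced_SDE_exists_unique
    {n p m k r : ℕ} (hrn : r ≤ n) (hp : p = n - r)
    (M : Set (Fin n → ℝ)) (hMopen : IsOpen M) (hMconn : IsConnected M)
    (μ : (Fin n → ℝ) → Fin n → ℝ) (σ : (Fin n → ℝ) → Fin n → Fin m → ℝ)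
    (hμsmooth : ContDiffOn ℝ (⊤ : ℕ∞) μ M) (hσsmooth : ContDiffOn ℝ (⊤ : ℕ∞) σ M)
    (M' : Set (Fin p → ℝ)) (hM'open : IsOpen M')
    (Ψ : (Fin n → ℝ) → Fin p → ℝ)
    (hΨsmooth : ContDiffOn ℝ (⊤ : ℕ∞) Ψ M)
    (hΨim : Ψ '' M = M')
    (hΨsubm : ∀ x ∈ M, Function.Surjective
      (fun v : Fin n → ℝ => (fun i => ∑ j, pd (fun y => Ψ y i) j x * v j : Fin p → ℝ)))
    (hfib : ∀ y ∈ M', IsConnected {x ∈ M | Ψ x = y})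
    (Y : Fin k → (Fin n → ℝ) → Fin n → ℝ)
    (hYsmooth : ∀ i, ContDiffOn ℝ (⊤ : ℕ∞) (Y i) M)
    (hrank : ∀ x ∈ M,
      Module.finrank ℝ (Submodule.span ℝ (Set.range fun i => Y i x)) = r)
    (hintegrable : ∀ i j, ∀ x ∈ M,
      vfBracket (Y i) (Y j) x ∈ Submodule.span ℝ (Set.range fun l => Y l x))
    (hker : ∀ x ∈ M, ∀ v : Fin n → ℝ,
      v ∈ Submodule.span ℝ (Set.range fun i => Y i x) ↔
        ∀ i, ∑ j, pd (fun y => Ψ y i) j x * v j = 0)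
    -- the `(Y_i,C_i,0)` are quasi-strong symmetries of `(μ,σ)`
    (C : Fin k → (Fin n → ℝ) → Fin m → Fin m → ℝ)
    (hCsmooth : ∀ i, ContDiffOn ℝ (⊤ : ℕ∞) (C i) M)
    (hCso : ∀ i, ∀ x ∈ M, ∀ a b, C i x a b = - C i x b a)
    (hsym : ∀ i, IsSymmetry M μ σ (Y i) (C i) (fun _ => 0))
    -- the condition `∇Ψ·σ·C_i = 0`
    (hσC : ∀ i, ∀ x ∈ M, ∀ i₀ : Fin p, ∀ a : Fin m,
      ∑ b, (∑ j, pd (fun y => Ψ y i₀) j x * σ x j b) * C i x b a = 0) :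
    ∃ (μ' : (Fin p → ℝ) → Fin p → ℝ) (σ' : (Fin p → ℝ) → Fin p → Fin m → ℝ),
      ContDiffOn ℝ (⊤ : ℕ∞) μ' M' ∧ ContDiffOn ℝ (⊤ : ℕ∞) σ' M' ∧
      (∀ x ∈ M, ∀ i, gen μ σ (fun y => Ψ y i) x = μ' (Ψ x) i) ∧
      (∀ x ∈ M, ∀ i a, ∑ j, pd (fun y => Ψ y i) j x * σ x j a = σ' (Ψ x) i a) ∧
      -- uniqueness
      (∀ (ν' : (Fin p → ℝ) → Fin p → ℝ) (ς' : (Fin p → ℝ) → Fin p → Fin m → ℝ),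
        ContDiffOn ℝ (⊤ : ℕ∞) ν' M' → ContDiffOn ℝ (⊤ : ℕ∞) ς' M' →
        (∀ x ∈ M, ∀ i, gen μ σ (fun y => Ψ y i) x = ν' (Ψ x) i) →
        (∀ x ∈ M, ∀ i a, ∑ j, pd (fun y => Ψ y i) j x * σ x j a = ς' (Ψ x) i a) →
        ∀ y ∈ M', ν' y = μ' y ∧ ς' y = σ' y) := by
  have hΨi : ∀ i, ContDiffOn ℝ (⊤ : ℕ∞) (fun y => Ψ y i) M := fun i => contDiffOn_pi.1 hΨsmooth i
  have hσa : ∀ a, ContDiffOn ℝ (⊤ : ℕ∞) (fun x i => σ x i a) M := fun a =>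
    contDiffOn_pi.2 fun i => contDiffOn_pi.1 (contDiffOn_pi.1 hσsmooth i) a
  have hΨd : ∀ x ∈ M, DifferentiableAt ℝ Ψ x := fun x hx =>
    (hΨsmooth.contDiffAt (hMopen.mem_nhds hx)).differentiableAt (by simp)
  have hYΨ : ∀ l i, ∀ x ∈ M, fderiv ℝ (fun y => Ψ y i) x (Y l x) = 0 := fun l i x hx => by
    rw [← sum_pd_mul]
    exact (hker x hx _).1 (Submodule.subset_span ⟨l, rfl⟩) i
  have hfactor : ∀ f : (Fin n → ℝ) → ℝ, ContDiffOn ℝ (⊤ : ℕ∞) f M →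
      (∀ x ∈ M, ∀ l, fderiv ℝ f x (Y l x) = 0) →
      ∃ g : (Fin p → ℝ) → ℝ, ContDiffOn ℝ (⊤ : ℕ∞) g M' ∧ ∀ x ∈ M, f x = g (Ψ x) := by
    intro f hf hfY
    rw [← hΨim]
    refine exists_contDiffOn_factor_of_ker_fderiv_le hMopen hΨsmooth hf ?_ ?_ ?_
    · intro x hx w
      obtain ⟨v, hv⟩ := hΨsubm x hx w
      refine ⟨v, ?_⟩
      rw [← hv]
      ext i
      exact ((sum_pd_mul _ x v).trans (fderiv_coord (hΨd x hx) i v)).symm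
    · intro y
      by_cases hy : y ∈ M'
      · exact (hfib y hy).isPreconnected
      · have hempty : {x ∈ M | Ψ x = y} = ∅ := by
          ext x
          simp only [Set.mem_ofPred_eq, Set.mem_empty_iff_false, iff_false, not_and]
          rintro hx rfl
          exact hy (hΨim ▸ Set.mem_image_of_mem Ψ hx)
        rw [hempty]
        exact isPreconnected_empty
    · intro x hx v hv
      have hspan : v ∈ Submodule.span ℝ (Set.range fun l => Y l x) := by
        rw [hker x hx]
        intro i
        rw [sum_pd_mul, fderiv_coord (hΨd x hx), hv]
        rfl
      have hle : Submodule.span ℝ (Set.range fun l => Y l x)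
          ≤ LinearMap.ker (fderiv ℝ f x : (Fin n → ℝ) →ₗ[ℝ] ℝ) := by
        rw [Submodule.span_le]
        rintro _ ⟨l, rfl⟩
        exact hfY x hx l
      exact hle hspan
  have hμ' : ∀ i, ∃ g : (Fin p → ℝ) → ℝ, ContDiffOn ℝ (⊤ : ℕ∞) g M' ∧
      ∀ x ∈ M, gen μ σ (fun y => Ψ y i) x = g (Ψ x) := by
    intro i
    have hf1 : ContDiffOn ℝ (⊤ : ℕ∞) (fderiv ℝ fun y => Ψ y i) M :=
      (hΨi i).fderiv_of_isOpen hMopen (by simp)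
    have hf2 := hf1.fderiv_of_isOpen (m := (⊤ : ℕ∞)) hMopen (by simp)
    obtain ⟨g, hg, hfg⟩ := hfactor
      (fun x => (1 / 2) * ∑ a, fderiv ℝ (fderiv ℝ fun y => Ψ y i) x (fun j => σ x j a)
        (fun j => σ x j a) + fderiv ℝ (fun y => Ψ y i) x (μ x))
      ((contDiffOn_const.mul (ContDiffOn.sum fun a _ =>
        (hf2.clm_apply (hσa a)).clm_apply (hσa a))).add (hf1.clm_apply hμsmooth))
      (fun x hx l => by
        obtain ⟨h1, h2⟩ := (hsym l).fderiv_eq hMopen hμsmooth hσa (hYsmooth l) hx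
        exact fderiv_generator_apply_eq_zero hMopen (hΨi i) (hYsmooth l) (hYΨ l i) hσa hμsmooth hx
          (hCso l x hx) h1 h2)
    exact ⟨g, hg, fun x hx =>
      (gen_eq μ σ ((hΨi i).contDiffAt (hMopen.mem_nhds hx))).trans (hfg x hx)⟩
  have hσ' : ∀ i a, ∃ g : (Fin p → ℝ) → ℝ, ContDiffOn ℝ (⊤ : ℕ∞) g M' ∧
      ∀ x ∈ M, ∑ j, pd (fun y => Ψ y i) j x * σ x j a = g (Ψ x) := by
    intro i a
    have hf1 : ContDiffOn ℝ (⊤ : ℕ∞) (fderiv ℝ fun y => Ψ y i) M :=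
      (hΨi i).fderiv_of_isOpen hMopen (by simp)
    obtain ⟨g, hg, hfg⟩ := hfactor
      (fun x => fderiv ℝ (fun y => Ψ y i) x (fun j => σ x j a)) (hf1.clm_apply (hσa a))
      (fun x hx l => by
        obtain ⟨h1, -⟩ := (hsym l).fderiv_eq hMopen hμsmooth hσa (hYsmooth l) hx
        refine fderiv_fderiv_apply_eq_zero_of_bracket hMopen (hΨi i) (hYsmooth l) (hYΨ l i) (hσa a)
          hx ?_ (h1 a)
        rw [← hσC l x hx i a, map_sum]
        refine Finset.sum_congr rfl fun b _ => ?_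
        rw [map_smul, sum_pd_mul _ x fun j => σ x j b, smul_eq_mul, mul_comm])
    exact ⟨g, hg, fun x hx => (sum_pd_mul _ x fun j => σ x j a).trans (hfg x hx)⟩
  choose μ' hμ's hμ'Ψ using hμ'
  choose σ' hσ's hσ'Ψ using hσ'
  refine ⟨fun y i => μ' i y, fun y i a => σ' i a y, contDiffOn_pi.2 hμ's,
    contDiffOn_pi.2 fun i => contDiffOn_pi.2 (hσ's i), fun x hx i => hμ'Ψ i x hx,
    fun x hx i a => hσ'Ψ i a x hx, ?_⟩
  intro ν' ς' _ _ hν hς y hy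
  obtain ⟨x, hx, rfl⟩ := hΨim ▸ hy
  refine ⟨funext fun i => ?_, funext fun i => funext fun a => ?_⟩
  · rw [← hν x hx, hμ'Ψ i x hx]
  · rw [← hς x hx, hσ'Ψ i a x hx]
end
end

section
/- Let (μ,σ) be a smooth SDE on an open set M ⊆ ℝ^n and let Y_1,…,Y_r be smooth vector fields on M in canonical form such that each (Y_j,0,0) is an infinitesimal symmetry of (μ,σ) (i.e., [Y_j,σ] = 0 and Y_j(μ^i) − L(Y_j^i) = 0 for all i). Then for every i ≤ r, every j with i ≤ j ≤ n and every α = 1,…,m, one has ∂_i(μ^j) = 0 and ∂_i(σ^j_α) = 0 on M; in particular, the j-th rows of μ and σ do not depend on the coordinates x^1,…,x^{min(j,r)}. -/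
noncomputable section

open scoped BigOperators

/-- The vector fields `Y_1,…,Y_r` are in canonical form on `U`: the `n × r` matrix
`(Y_1|…|Y_r)` has a block-triangular structure with identity blocks `I_{i_1},…,I_{i_l}` on the
block diagonal, zero blocks below it, and zeros in the last `n - r` rows.  The blocks are
recorded by the strictly increasing sequence of partial sums `s 0 = 0 < s 1 < … < s l = r`. -/
def IsCanonicalForm {n r : ℕ} (hrn : r ≤ n)
    (Y : Fin r → (Fin n → ℝ) → Fin n → ℝ) (U : Set (Fin n → ℝ)) : Prop :=
  ∃ (l : ℕ) (s : Fin (l + 1) → ℕ), StrictMono s ∧ s 0 = 0 ∧ s (Fin.last l) = r ∧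
    (∀ x ∈ U, ∀ j : Fin r, ∀ i : Fin n, r ≤ (i : ℕ) → Y j x i = 0) ∧
    (∀ x ∈ U, ∀ t : Fin l, ∀ i j : Fin r,
      s t.castSucc ≤ (i : ℕ) → (i : ℕ) < s t.succ →
      s t.castSucc ≤ (j : ℕ) → (j : ℕ) < s t.succ →
      Y j x (Fin.castLE hrn i) = if (i : ℕ) = (j : ℕ) then 1 else 0) ∧
    (∀ x ∈ U, ∀ t t' : Fin l, t' < t → ∀ i j : Fin r,
      s t.castSucc ≤ (i : ℕ) → (i : ℕ) < s t.succ →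
      s t'.castSucc ≤ (j : ℕ) → (j : ℕ) < s t'.succ →
      Y j x (Fin.castLE hrn i) = 0)

lemma pd_congr_of_eventuallyEq {d : ℕ} {f g : (Fin d → ℝ) → ℝ} {x : Fin d → ℝ}
    (h : f =ᶠ[nhds x] g) (j : Fin d) : pd f j x = pd g j x := by
  unfold pd
  rw [h.fderiv_eq]

lemma pd_eq_zero_of_eqOn_const {d : ℕ} {M : Set (Fin d → ℝ)} (hM : IsOpen M)
    {f : (Fin d → ℝ) → ℝ} {c : ℝ} (hf : ∀ x ∈ M, f x = c) {x : Fin d → ℝ} (hx : x ∈ M)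
    (j : Fin d) : pd f j x = 0 := by
  have h : f =ᶠ[nhds x] fun _ => c := by
    filter_upwards [hM.mem_nhds hx] with y hy using hf y hy
  rw [pd_congr_of_eventuallyEq h]
  simp [pd]

/-- The generator annihilates functions that are constant on an open set. -/
lemma gen_eq_zero_of_eqOn_const {d m : ℕ} {M : Set (Fin d → ℝ)} (hM : IsOpen M)
    (μ : (Fin d → ℝ) → Fin d → ℝ) (σ : (Fin d → ℝ) → Fin d → Fin m → ℝ)
    {f : (Fin d → ℝ) → ℝ} {c : ℝ} (hf : ∀ x ∈ M, f x = c) {x : Fin d → ℝ} (hx : x ∈ M) :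
    gen μ σ f x = 0 := by
  have h₁ : ∀ j, ∀ y ∈ M, pd f j y = 0 := fun j y hy => pd_eq_zero_of_eqOn_const hM hf hy j
  have h₂ : ∀ i j, pd (fun y => pd f j y) i x = 0 := fun i j =>
    pd_eq_zero_of_eqOn_const hM (h₁ j) hx i
  simp [gen, h₁ _ x hx, h₂]

/-- A number below the last value of a sequence starting at `0` lies in one of the intervals
between consecutive values. -/
lemma exists_castSucc_le_lt_succ {l : ℕ} (s : Fin (l + 1) → ℕ) (h0 : s 0 = 0) {i : ℕ}
    (hi : i < s (Fin.last l)) : ∃ t : Fin l, s t.castSucc ≤ i ∧ i < s t.succ := by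
  by_contra! h
  have key : ∀ p : Fin (l + 1), s p ≤ i := by
    intro p
    induction p using Fin.induction with
    | zero => omega
    | succ t ih => exact h t ih
  exact absurd (key (Fin.last l)) (by omega)

/-- In canonical form, the entries on and below the diagonal are those of the identity. -/
lemma IsCanonicalForm.apply_of_le {n r : ℕ} {hrn : r ≤ n}
    {Y : Fin r → (Fin n → ℝ) → Fin n → ℝ} {U : Set (Fin n → ℝ)}
    (h : IsCanonicalForm hrn Y U) {x : Fin n → ℝ} (hx : x ∈ U) (i : Fin r) (k : Fin n)
    (hik : (i : ℕ) ≤ k) : Y i x k = if (k : ℕ) = i then 1 else 0 := by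
  obtain ⟨l, s, hs, h0, hlast, hzero, hdiag, hbelow⟩ := h
  by_cases hk : r ≤ (k : ℕ)
  · rw [hzero x hx i k hk, if_neg (by omega)]
  push Not at hk
  obtain ⟨ti, hi₁, hi₂⟩ := exists_castSucc_le_lt_succ s h0 (i := i) (by omega)
  obtain ⟨tk, hk₁, hk₂⟩ := exists_castSucc_le_lt_succ s h0 (i := k) (by omega)
  rcases lt_trichotomy ti tk with hlt | rfl | hgt
  · have hle : s ti.succ ≤ s tk.castSucc := hs.monotone (by
      simp only [Fin.le_def, Fin.lt_def, Fin.val_succ, Fin.val_castSucc] at *; omega)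
    rw [if_neg (by omega)]
    exact hbelow x hx tk ti hlt ⟨k, hk⟩ i hk₁ hk₂ hi₁ hi₂
  · exact hdiag x hx ti ⟨k, hk⟩ i hk₁ hk₂ hi₁ hi₂
  · have hle : s tk.succ ≤ s ti.castSucc := hs.monotone (by
      simp only [Fin.le_def, Fin.lt_def, Fin.val_succ, Fin.val_castSucc] at *; omega)
    omega

/-- If `∂_k f` vanishes for all `k < i`, then a canonical field `Y_i` acts on `f` as `∂_i`. -/
lemma IsCanonicalForm.vfApp_eq_pd {n r : ℕ} {hrn : r ≤ n}
    {Y : Fin r → (Fin n → ℝ) → Fin n → ℝ} {U : Set (Fin n → ℝ)}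
    (h : IsCanonicalForm hrn Y U) {x : Fin n → ℝ} (hx : x ∈ U) (i : Fin r)
    {f : (Fin n → ℝ) → ℝ} (hf : ∀ k : Fin n, (k : ℕ) < i → pd f k x = 0) :
    vfApp (Y i) f x = pd f (Fin.castLE hrn i) x := by
  unfold vfApp
  rw [Finset.sum_eq_single (Fin.castLE hrn i)]
  · rw [h.apply_of_le hx i _ (by simp)]
    simp
  · intro k _ hk
    rcases lt_or_ge (k : ℕ) i with hlt | hge
    · rw [hf k hlt, mul_zero]
    · rw [h.apply_of_le hx i k hge, if_neg (show ¬(k : ℕ) = i from fun e => hk (Fin.ext e)), zero_mul]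
  · simp

/-- from the proofs of Theorems 4.5 and 4.7.  If `Y_1,…,Y_r` are strong
symmetries of `(μ,σ)` in canonical form, then for `i ≤ r` and `i ≤ j ≤ n` the entries `μ^j`
and `σ^j_α` do not depend on the coordinate `x^i`. -/
theorem canonical_strong_symmetries_triangular_structure
    {n m r : ℕ} (hrn : r ≤ n)
    (M : Set (Fin n → ℝ)) (hMopen : IsOpen M)
    (μ : (Fin n → ℝ) → Fin n → ℝ) (σ : (Fin n → ℝ) → Fin n → Fin m → ℝ)
    (hμsmooth : ContDiffOn ℝ (⊤ : ℕ∞) μ M) (hσsmooth : ContDiffOn ℝ (⊤ : ℕ∞) σ M)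
    (Y : Fin r → (Fin n → ℝ) → Fin n → ℝ)
    (hYsmooth : ∀ j, ContDiffOn ℝ (⊤ : ℕ∞) (Y j) M)
    (hcanon : IsCanonicalForm hrn Y M)
    (hsym : ∀ j, IsSymmetry M μ σ (Y j)
      (fun _ _ _ => (0:ℝ)) (fun _ => (0:ℝ))) :
    ∀ x ∈ M, ∀ i j : Fin n, (i : ℕ) < r → (i : ℕ) ≤ (j : ℕ) →
      pd (fun y => μ y j) i x = 0 ∧ ∀ α : Fin m, pd (fun y => σ y j α) i x = 0 := by
  have hconst : ∀ (i : Fin r) (j : Fin n), (i : ℕ) ≤ j → ∀ x ∈ M,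
      Y i x j = if (j : ℕ) = i then 1 else 0 := fun i j hij x hx =>
    hcanon.apply_of_le hx i j hij
  have hμ : ∀ (i : Fin r) (j : Fin n), (i : ℕ) ≤ j → ∀ x ∈ M,
      vfApp (Y i) (fun y => μ y j) x = 0 := by
    intro i j hij x hx
    have h := (hsym i).2 x hx j
    rw [gen_eq_zero_of_eqOn_const hMopen μ σ (hconst i j hij) hx] at h
    simpa using h
  have hσ : ∀ (i : Fin r) (j : Fin n), (i : ℕ) ≤ j → ∀ x ∈ M, ∀ α : Fin m,
      vfApp (Y i) (fun y => σ y j α) x = 0 := by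
    intro i j hij x hx α
    have h := (hsym i).1 x hx j α
    simpa [mixBracket, vfApp, pd_eq_zero_of_eqOn_const hMopen (hconst i j hij) hx] using h
  have main : ∀ (p : ℕ) (hp : p < r) (j : Fin n), p ≤ (j : ℕ) → ∀ x ∈ M,
      pd (fun y => μ y j) (Fin.castLE hrn ⟨p, hp⟩) x = 0 ∧
        ∀ α : Fin m, pd (fun y => σ y j α) (Fin.castLE hrn ⟨p, hp⟩) x = 0 := by
    intro p
    induction p using Nat.strong_induction_on with
    | _ p ih =>
      intro hp j hpj x hx
      have hprev : ∀ k : Fin n, (k : ℕ) < p → pd (fun y => μ y j) k x = 0 ∧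
          ∀ α : Fin m, pd (fun y => σ y j α) k x = 0 := fun k hk =>
        ih k hk (by omega) j (by omega) x hx
      refine ⟨?_, fun α => ?_⟩
      · rw [← hcanon.vfApp_eq_pd hx ⟨p, hp⟩ fun k hk => (hprev k hk).1]
        exact hμ ⟨p, hp⟩ j hpj x hx
      · rw [← hcanon.vfApp_eq_pd hx ⟨p, hp⟩ fun k hk => (hprev k hk).2 α]
        exact hσ ⟨p, hp⟩ j hpj x hx α
  intro x hx i j hi hij
  exact main i hi j hij x hx
end
end
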